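/- arXiv:math/0503327 — 3 statements merged into one kernel-verified Lean document; each statement's English description precedes it below -/
import Mathlib

section
/- For every positive integer m and every Dyck word w of length 2m, the number of matchings on [2m] with base w avoiding every matching of the family 𝒞 = {C_k : k ≥ 3} equals the number of matchings on [2m] with base w avoiding M_132; that is, g(m,w,𝒞) = g(m,w,M_132). -/
/-- `G` is a matching on the vertex set `[n] = {1,…,n}`:
every edge has both endpoints in `[n]`, and every vertex of `[n]` has exactly one neighbour. -/
def IsMatchingOn (n : ℕ) (G : SimpleGraph ℕ) : Prop :=
  (∀ u v : ℕ, G.Adj u v → 1 ≤ u ∧ u ≤ n ∧ 1 ≤ v ∧ v ≤ n) ∧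
  (∀ v : ℕ, 1 ≤ v → v ≤ n → ∃! u : ℕ, G.Adj v u)

/-- `G` contains `H`: there is a monotone edge-preserving injection from the
vertices of `H` to those of `G`. -/
def ContainsPat (G H : SimpleGraph ℕ) : Prop :=
  ∃ f : ℕ → ℕ, StrictMono f ∧ ∀ u v : ℕ, H.Adj u v → G.Adj (f u) (f v)

/-- `w` (on positions `1,…,n`) is a Dyck word of length `n`: exactly half of its letters
are `1` (`true`), and every prefix has at most half of its letters equal to `1`. -/
def IsDyckWord (n : ℕ) (w : ℕ → Bool) : Prop :=
  2 * ((Finset.Icc 1 n).filter fun i => w i = true).card = n ∧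
  ∀ k : ℕ, k ≤ n → 2 * ((Finset.Icc 1 k).filter fun i => w i = true).card ≤ k

/-- The matching `G` on `[n]` has base `w`: `w i = 1` iff `i` is an r-vertex. -/
def HasBase (n : ℕ) (G : SimpleGraph ℕ) (w : ℕ → Bool) : Prop :=
  ∀ i : ℕ, 1 ≤ i → i ≤ n → (w i = true ↔ ∃ j : ℕ, j < i ∧ G.Adj i j)

/-- The matching `M_123` on `[6]`, with edges `{1,4},{2,5},{3,6}`. -/
def M123 : SimpleGraph ℕ := SimpleGraph.fromRel fun u v => (u, v) ∈ [(1,4),(2,5),(3,6)]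
/-- The matching `M_132` on `[6]`, with edges `{1,4},{2,6},{3,5}`. -/
def M132 : SimpleGraph ℕ := SimpleGraph.fromRel fun u v => (u, v) ∈ [(1,4),(2,6),(3,5)]
/-- The matching `M_213` on `[6]`, with edges `{1,5},{2,4},{3,6}`. -/
def M213 : SimpleGraph ℕ := SimpleGraph.fromRel fun u v => (u, v) ∈ [(1,5),(2,4),(3,6)]
/-- The matching `M_231` on `[6]`, with edges `{1,5},{2,6},{3,4}`. -/
def M231 : SimpleGraph ℕ := SimpleGraph.fromRel fun u v => (u, v) ∈ [(1,5),(2,6),(3,4)]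
/-- The matching `M_321` on `[6]`, with edges `{1,6},{2,5},{3,4}`. -/
def M321 : SimpleGraph ℕ := SimpleGraph.fromRel fun u v => (u, v) ∈ [(1,6),(2,5),(3,4)]

/-- The matching `C_k` on `[2k]`, with edges `{2i-1, 2i+2}` for `1 ≤ i < k`
together with the edge `{2, 2k-1}`. -/
def Ck (k : ℕ) : SimpleGraph ℕ :=
  SimpleGraph.fromRel fun u v =>
    (∃ i : ℕ, 1 ≤ i ∧ i < k ∧ u = 2*i - 1 ∧ v = 2*i + 2) ∨ (u = 2 ∧ v = 2*k - 1)

/-- `G[k]`: the subgraph of `G` induced by the vertex set `[k]`. -/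
def restrictG (G : SimpleGraph ℕ) (k : ℕ) : SimpleGraph ℕ :=
  SimpleGraph.fromRel fun u v => G.Adj u v ∧ u ≤ k ∧ v ≤ k

/-- A stub of a graph on `[k]`: an isolated vertex. -/
def IsStubOn (k : ℕ) (G : SimpleGraph ℕ) (v : ℕ) : Prop :=
  1 ≤ v ∧ v ≤ k ∧ ∀ u : ℕ, ¬ G.Adj v u

/-- The relation `∼`: `u ∼ v` iff `u = v` or some edge `{x,y}` satisfies
`x < u < y` and `x < v < y`. -/
def SimRel (G : SimpleGraph ℕ) (u v : ℕ) : Prop :=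
  u = v ∨ ∃ x y : ℕ, G.Adj x y ∧ x < u ∧ u < y ∧ x < v ∧ v < y

/-- The edges `{a,b}` and `{c,d}` (with `a < b`, `c < d`) cross. -/
def EdgesCross (a b c d : ℕ) : Prop :=
  (a < c ∧ c < b ∧ b < d) ∨ (c < a ∧ a < d ∧ d < b)

/-- The relation `≈`: `u ≈ v` iff `u = v` or there is a sequence of edges
`e_1,…,e_p` (`p ≥ 1`), consecutive ones crossing, with `e_1` spanning `u` and `e_p` spanning `v`. -/
def ApproxRel (G : SimpleGraph ℕ) (u v : ℕ) : Prop :=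
  u = v ∨ ∃ p : ℕ, 1 ≤ p ∧ ∃ x y : ℕ → ℕ,
    (∀ i : ℕ, i < p → x i < y i ∧ G.Adj (x i) (y i)) ∧
    (∀ i : ℕ, i + 1 < p → EdgesCross (x i) (y i) (x (i+1)) (y (i+1))) ∧
    x 0 < u ∧ u < y 0 ∧ x (p-1) < v ∧ v < y (p-1)

/-- A relation `D G r u v` between vertices `u < v`, read off from the edges of `G` below `r`,
together with a forbidden configuration `Bad G r s t` (closing `s` at time `r` while `t` is still
open) and a rule `sel` choosing the only stub of a class which may be closed. -/
structure LinkSystem (D Bad : SimpleGraph ℕ → ℕ → ℕ → ℕ → Prop) (sel : List ℕ → ℕ) : Prop where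
  lt : ∀ {G r u v}, D G r u v → 0 < u ∧ u < v ∧ v + 1 < r
  mono : ∀ {G H r r' u v}, (∀ a b, a < b → b < r → G.Adj a b → b < r' ∧ H.Adj a b) →
    D G r u v → D H r' u v
  bad_mono : ∀ {G H r s t}, (∀ a b, a < b → b < r → G.Adj a b → H.Adj a b) →
    Bad G r s t → Bad H r s t
  bad_link : ∀ {G r s t}, Bad G r s t → D G r s t ∨ D G r t s
  close : ∀ {G k s u v}, (∀ a b, G.Adj a b → 1 ≤ a ∧ a ≤ k) → s ≤ k → v ≤ k → u < v →
    (∀ a, ¬ G.Adj u a) → (∀ a, ¬ G.Adj v a) → ¬ Bad G (k + 1) s u →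
    (D (G ⊔ SimpleGraph.edge s (k + 1)) (k + 2) u v ↔
      D G (k + 1) u v ∨ s < u ∨ (u < s ∧ s < v ∧ D G (k + 1) u s))
  sel_mem : ∀ {c}, c ≠ [] → sel c ∈ c
  sel_not_bad : ∀ {G r c t}, c.Pairwise (· > ·) → t ∈ c → ¬ Bad G r (sel c) t
  bad_of_ne_sel : ∀ {G r c s}, c.Pairwise (· > ·) → s ∈ c → s ≠ sel c →
    (∀ u ∈ c, ∀ v ∈ c, u < v → D G r u v) → Bad G r s (sel c)

/-- No edge `{s, r}` is closed badly with respect to a vertex `t` still open at time `r`. -/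
def BadFree (Bad : SimpleGraph ℕ → ℕ → ℕ → ℕ → Prop) (G : SimpleGraph ℕ) : Prop :=
  ∀ s r t, G.Adj s r → s < r → (∀ z, G.Adj t z → r < z) → ¬ Bad G r s t

/-- `P` is a partial matching on `[k]` with base `w`, free of bad configurations, whose stubs are
listed decreasingly in `L`, grouped into their classes. -/
structure PartialState (D Bad : SimpleGraph ℕ → ℕ → ℕ → ℕ → Prop) (w : ℕ → Bool) (k : ℕ)
    (P : SimpleGraph ℕ) (L : List (List ℕ)) : Prop where
  bound : ∀ a b, P.Adj a b → 1 ≤ a ∧ a ≤ k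
  unique : ∀ a b c, P.Adj a b → P.Adj a c → b = c
  base : HasBase k P w
  stubs : ∀ v, v ∈ L.flatten ↔ 1 ≤ v ∧ v ≤ k ∧ ∀ a, ¬ P.Adj v a
  sorted : L.flatten.Pairwise (· > ·)
  link : ∀ u ∈ L.flatten, ∀ v ∈ L.flatten, u < v →
    (D P (k + 1) u v ↔ ∃ c ∈ L, u ∈ c ∧ v ∈ c)
  free : BadFree Bad P

/-- The number of ways to process the last `r` letters of the word `w` of length `n`, starting
with stub classes of the given sizes (most recent class first): opening a vertex creates a class of
size one, and closing a vertex of a class removes it and merges this class with all later ones. -/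
def countFrom (n : ℕ) (w : ℕ → Bool) : ℕ → List ℕ → ℕ
  | 0, σ => if σ.sum = 0 then 1 else 0
  | r + 1, σ =>
    if w (n - r) = true then
      ∑ i : Fin σ.length,
        if σ[i] = 0 then 0
        else countFrom n w r (((σ.take (i + 1)).sum - 1) :: σ.drop (i + 1))
    else countFrom n w r (1 :: σ)

/-- The matchings on `[n]` with base `w`, free of bad configurations, that restrict to `P`
on `[k]`. -/
def completions (Bad : SimpleGraph ℕ → ℕ → ℕ → ℕ → Prop) (w : ℕ → Bool) (n k : ℕ)
    (P : SimpleGraph ℕ) : Set (SimpleGraph ℕ) :=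
  {G | IsMatchingOn n G ∧ HasBase n G w ∧ BadFree Bad G ∧
    ∀ a b, P.Adj a b ↔ G.Adj a b ∧ a ≤ k ∧ b ≤ k}

lemma sup_edge_adj {P : SimpleGraph ℕ} {s r : ℕ} (h : s < r) (a b : ℕ) :
    (P ⊔ SimpleGraph.edge s r).Adj a b ↔
      P.Adj a b ∨ (a = s ∧ b = r) ∨ (a = r ∧ b = s) := by
  rw [SimpleGraph.sup_adj, SimpleGraph.edge_adj]
  constructor
  · rintro (h | ⟨h, -⟩)
    · exact .inl h
    · grind
  · rintro (h | h)
    · exact .inl h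
    · right; grind

namespace PartialState

variable {D Bad : SimpleGraph ℕ → ℕ → ℕ → ℕ → Prop} {sel : List ℕ → ℕ} {w : ℕ → Bool} {k : ℕ}
  {P : SimpleGraph ℕ} {L : List (List ℕ)}

lemma bound_right (h : PartialState D Bad w k P L) {a b : ℕ} (hab : P.Adj a b) :
    1 ≤ b ∧ b ≤ k := h.bound b a hab.symm

lemma sel_mem_flatten (S : LinkSystem D Bad sel) {c : List ℕ} (hc : c ∈ L) (hne : c ≠ []) :
    sel c ∈ L.flatten :=
  List.mem_flatten_of_mem hc (S.sel_mem hne)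

lemma class_sorted (h : PartialState D Bad w k P L) {c : List ℕ} (hc : c ∈ L) :
    c.Pairwise (· > ·) :=
  (List.pairwise_flatten.1 h.sorted).1 c hc

lemma class_unique (h : PartialState D Bad w k P L) {c d : List ℕ} {v : ℕ} (hc : c ∈ L)
    (hd : d ∈ L) (hvc : v ∈ c) (hvd : v ∈ d) : c = d := by
  by_contra hne
  have h2 := (List.pairwise_flatten.1 h.sorted).2
  have h3 : L.Pairwise List.Disjoint :=
    h2.imp fun {a b} hab x hxa hxb => absurd (hab x hxa x hxb) (lt_irrefl x)
  have : Std.Symm (List.Disjoint (α := ℕ)) := ⟨fun _ _ h => h.symm⟩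
  exact h3.forall hc hd hne hvc hvd

lemma not_bad_sel (S : LinkSystem D Bad sel) (h : PartialState D Bad w k P L) {c : List ℕ}
    (hc : c ∈ L) (hne : c ≠ []) {t : ℕ} (ht : ∀ a, ¬ P.Adj t a) : ¬ Bad P (k + 1) (sel c) t := by
  intro hb
  have hs := sel_mem_flatten S hc hne
  have htk : t ∈ L.flatten := by
    rw [h.stubs]
    rcases S.bad_link hb with hd | hd <;> have := S.lt hd <;> exact ⟨by omega, by omega, ht⟩
  have : ∃ c' ∈ L, sel c ∈ c' ∧ t ∈ c' := by
    rcases S.bad_link hb with hd | hd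
    · exact (h.link _ hs _ htk (S.lt hd).2.1).1 hd
    · obtain ⟨c', h1, h2, h3⟩ := (h.link _ htk _ hs (S.lt hd).2.1).1 hd
      exact ⟨c', h1, h3, h2⟩
  obtain ⟨c', h1, h2, h3⟩ := this
  obtain rfl := h.class_unique h1 hc h2 (S.sel_mem hne)
  exact S.sel_not_bad (h.class_sorted hc) h3 hb

lemma empty : PartialState D Bad w 0 ⊥ [] where
  bound := by simp
  unique := by simp
  base := by intro i; omega
  stubs := by intro v; simp; omega
  sorted := by simp
  link := by simp
  free := by simp [BadFree]

lemma push (S : LinkSystem D Bad sel) (h : PartialState D Bad w k P L) (hw : ¬ w (k + 1) = true) :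
    PartialState D Bad w (k + 1) P ([k + 1] :: L) where
  bound := fun a b hab => by have := h.bound a b hab; omega
  unique := h.unique
  base := by
    intro i h1 h2
    rcases Nat.lt_or_ge k i with hi | hi
    · obtain rfl : i = k + 1 := by omega
      simp only [hw, false_iff, Bool.false_eq_true]
      rintro ⟨j, -, hj⟩
      have := h.bound _ _ hj
      omega
    · exact h.base i h1 hi
  stubs := by
    intro v
    simp only [List.flatten_cons, List.singleton_append, List.mem_cons, h.stubs]
    constructor
    · rintro (rfl | ⟨h1, h2, h3⟩)
      · refine ⟨by omega, le_rfl, fun a ha => ?_⟩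
        have := h.bound _ _ ha
        omega
      · exact ⟨h1, by omega, h3⟩
    · rintro ⟨h1, h2, h3⟩
      rcases Nat.lt_or_ge k v with hi | hi
      · left; omega
      · exact .inr ⟨h1, hi, h3⟩
  sorted := by
    simp only [List.flatten_cons, List.singleton_append, List.pairwise_cons]
    refine ⟨fun a ha => ?_, h.sorted⟩
    have := (h.stubs a).1 ha
    omega
  link := by
    intro u hu v hv huv
    simp only [List.flatten_cons, List.singleton_append, List.mem_cons] at hu hv
    have hle : ∀ x ∈ L.flatten, x ≤ k := fun x hx => ((h.stubs x).1 hx).2.1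
    have hu' : u ∈ L.flatten := by
      rcases hu with rfl | hu
      · rcases hv with rfl | hv
        · omega
        · have := hle v hv; omega
      · exact hu
    have huk := hle u hu'
    have hD : D P (k + 1 + 1) u v ↔ D P (k + 1) u v :=
      ⟨S.mono fun a b _ _ hab => ⟨by have := h.bound_right hab; omega, hab⟩,
        S.mono fun a b _ _ hab => ⟨by omega, hab⟩⟩
    rcases hv with rfl | hv
    · constructor
      · intro hd
        have := S.lt hd
        omega
      · rintro ⟨c, hc, huc, hvc⟩
        rcases List.mem_cons.1 hc with rfl | hc
        · simp only [List.mem_singleton] at huc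
          omega
        · have := hle _ (List.mem_flatten_of_mem hc hvc)
          omega
    · rw [hD, h.link u hu' v hv huv]
      simp only [List.mem_cons, exists_eq_or_imp, List.not_mem_nil, or_false]
      constructor
      · exact .inr
      · rintro (⟨rfl, -⟩ | h')
        · omega
        · exact h'
  free := h.free

lemma close (S : LinkSystem D Bad sel) {A B : List (List ℕ)} {c : List ℕ}
    (h : PartialState D Bad w k P (A ++ c :: B)) (hne : c ≠ []) (hw : w (k + 1) = true) :
    PartialState D Bad w (k + 1) (P ⊔ SimpleGraph.edge (sel c) (k + 1))
      ((A.flatten ++ c.erase (sel c)) :: B) := by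
  have hcL : c ∈ A ++ c :: B := by simp
  have hsc := S.sel_mem hne
  have hnb := fun t => h.not_bad_sel S hcL hne (t := t)
  have hsf := sel_mem_flatten S hcL hne
  generalize sel c = s at *
  obtain ⟨hs1, hsk, hstub⟩ := (h.stubs s).1 hsf
  have hadj := sup_edge_adj (P := P) (show s < k + 1 by omega)
  have hstub' : ∀ a, ¬ P.Adj a s := fun a ha => hstub a ha.symm
  have hk' : ∀ a, ¬ P.Adj a (k + 1) := fun a ha => by have := h.bound_right ha; omega
  have hk : ∀ a, ¬ P.Adj (k + 1) a := fun a ha => hk' a ha.symm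
  have hsorted := h.sorted
  simp only [List.flatten_append, List.flatten_cons, List.pairwise_append, List.mem_append]
    at hsorted
  obtain ⟨hA, ⟨hc, hB, hcB⟩, hAcB⟩ := hsorted
  have hmem : ∀ v, v ∈ ((A.flatten ++ c.erase s) :: B).flatten ↔
      v ∈ (A ++ c :: B).flatten ∧ v ≠ s := by
    intro v
    have hnd : c.Nodup := hc.imp fun h => ne_of_gt h
    simp only [List.flatten_append, List.flatten_cons, List.mem_append, hnd.mem_erase_iff]
    constructor
    · rintro ((hv | hv) | hv)
      · exact ⟨.inl hv, ne_of_gt (hAcB v hv s (.inl hsc))⟩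
      · exact ⟨.inr (.inl hv.2), hv.1⟩
      · exact ⟨.inr (.inr hv), ne_of_lt (hcB s hsc v hv)⟩
    · tauto
  refine ⟨?_, ?_, ?_, ?_, ?_, ?_, ?_⟩
  · intro a b hab
    rcases (hadj a b).1 hab with hab | hab | hab
    · have := h.bound a b hab; omega
    · omega
    · omega
  · intro a b b' hb hb'
    rw [hadj] at hb hb'
    rcases hb with hb | ⟨rfl, rfl⟩ | ⟨rfl, rfl⟩ <;> rcases hb' with hb' | ⟨h1, rfl⟩ | ⟨h1, rfl⟩
    · exact h.unique _ _ _ hb hb'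
    · exact absurd (h1 ▸ hb) (hstub _)
    · exact absurd (h1 ▸ hb) (hk _)
    · exact absurd hb' (hstub _)
    · rfl
    · omega
    · exact absurd hb' (hk _)
    · omega
    · rfl
  · intro i h1 h2
    rcases Nat.lt_or_ge k i with hi | hi
    · obtain rfl : i = k + 1 := by omega
      simp only [hw, true_iff]
      exact ⟨s, by omega, (hadj _ _).2 (.inr (.inr ⟨rfl, rfl⟩))⟩
    · rw [h.base i h1 hi]
      refine exists_congr fun j => and_congr_right fun hj => ?_
      rw [hadj]
      constructor
      · exact .inl
      · rintro (h' | h' | h')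
        · exact h'
        · omega
        · omega
  · intro v
    rw [hmem, h.stubs]
    simp only [hadj]
    constructor
    · rintro ⟨⟨h1, h2, h3⟩, h4⟩
      refine ⟨h1, by omega, fun a ha => ?_⟩
      rcases ha with ha | ha | ha
      · exact h3 a ha
      · omega
      · omega
    · rintro ⟨h1, h2, h3⟩
      have h5 : v ≠ s := fun hv => h3 (k + 1) (.inr (.inl ⟨hv, rfl⟩))
      have h6 : v ≠ k + 1 := fun hv => h3 s (.inr (.inr ⟨hv, rfl⟩))
      exact ⟨⟨h1, by omega, fun a ha => h3 a (.inl ha)⟩, h5⟩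
  · refine h.sorted.sublist ?_
    simp only [List.flatten_append, List.flatten_cons, List.append_assoc]
    exact (List.Sublist.refl _).append (List.erase_sublist.append (List.Sublist.refl _))
  · intro u hu v hv huv
    obtain ⟨huL, hus⟩ := (hmem u).1 hu
    obtain ⟨hvL, hvs⟩ := (hmem v).1 hv
    obtain ⟨hu1, huk, hustub⟩ := (h.stubs u).1 huL
    obtain ⟨hv1, hvk, hvstub⟩ := (h.stubs v).1 hvL
    rw [S.close h.bound hsk hvk huv hustub hvstub (hnb u hustub)]
    have hnotB : ∀ x ∈ ((A.flatten ++ c.erase s) :: B).flatten, x ∉ B.flatten →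
        x ∈ A.flatten ++ c.erase s := by
      intro x hx hxB
      rw [List.flatten_cons, List.mem_append] at hx
      tauto
    have hsB : ∀ x ∈ B.flatten, x < s := fun x hx => hcB s hsc x hx
    have key : (s < v ∨ v ∈ c) → u ∈ A.flatten ++ c.erase s →
        ∃ d ∈ (A.flatten ++ c.erase s) :: B, u ∈ d ∧ v ∈ d := by
      refine fun hv' hu' => ⟨_, List.mem_cons_self, hu', hnotB v hv fun hvB => ?_⟩
      rcases hv' with hv' | hv'
      · exact absurd (hsB v hvB) (by omega)
      · exact absurd (hcB v hv' v hvB) (lt_irrefl _)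
    constructor
    · rintro (hD | hsu | ⟨hlt, hsv, hD⟩)
      · obtain ⟨d, hd, hud, hvd⟩ := (h.link u huL v hvL huv).1 hD
        rcases List.mem_append.1 hd with hdA | hd
        · refine ⟨_, List.mem_cons_self, ?_, ?_⟩ <;>
            exact List.mem_append_left _ (List.mem_flatten_of_mem hdA ‹_›)
        · rcases List.mem_cons.1 hd with rfl | hdB
          · exact ⟨_, List.mem_cons_self, List.mem_append_right _ ((List.mem_erase_of_ne hus).2 hud),
              List.mem_append_right _ ((List.mem_erase_of_ne hvs).2 hvd)⟩
          · exact ⟨d, List.mem_cons_of_mem _ hdB, hud, hvd⟩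
      · exact key (.inl (by omega)) (hnotB u hu fun hB => absurd (hsB u hB) (by omega))
      · obtain ⟨d, hd, hud, hsd⟩ := (h.link u huL s hsf hlt).1 hD
        obtain rfl := h.class_unique hd hcL hsd hsc
        exact key (.inl hsv) (List.mem_append_right _ ((List.mem_erase_of_ne hus).2 hud))
    · rintro ⟨d, hd, hud, hvd⟩
      rcases List.mem_cons.1 hd with rfl | hdB
      · rcases Nat.lt_or_gt_of_ne hus with hlt | hgt
        · have huc : u ∈ c := by
            rcases List.mem_append.1 hud with hu' | hu'
            · exact absurd (hAcB u hu' s (.inl hsc)) (by omega)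
            · exact List.mem_of_mem_erase hu'
          rcases List.mem_append.1 hvd with hv' | hv'
          · exact .inr (.inr ⟨hlt, hAcB v hv' s (.inl hsc),
              (h.link u huL s hsf hlt).2 ⟨c, hcL, huc, hsc⟩⟩)
          · exact .inl ((h.link u huL v hvL huv).2 ⟨c, hcL, huc, List.mem_of_mem_erase hv'⟩)
        · exact .inr (.inl hgt)
      · exact .inl ((h.link u huL v hvL huv).2 ⟨d, by simp [hdB], hud, hvd⟩)
  · intro s' r' t h1 h2 h3 hb
    rcases (hadj _ _).1 h1 with h1 | ⟨rfl, rfl⟩ | h1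
    · refine h.free s' r' t h1 h2 (fun z hz => h3 z ((hadj _ _).2 (.inl hz))) (S.bad_mono ?_ hb)
      intro a b _ hbr hab
      have := h.bound_right h1
      rcases (hadj _ _).1 hab with hab | hab | hab
      · exact hab
      · omega
      · omega
    · refine hnb t (fun a ha => ?_) (S.bad_mono ?_ hb)
      · have := h3 a ((hadj _ _).2 (.inl ha))
        have := h.bound_right ha
        omega
      · intro a b _ hbr hab
        rcases (hadj _ _).1 hab with hab | hab | hab
        · exact hab
        · omega
        · omega
    · omega

end PartialState

section Counting

variable {D Bad : SimpleGraph ℕ → ℕ → ℕ → ℕ → Prop} {sel : List ℕ → ℕ} {w : ℕ → Bool} {n k : ℕ}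
  {P : SimpleGraph ℕ} {L : List (List ℕ)}

lemma completions_full (h : PartialState D Bad w n P L) :
    (completions Bad w n n P).encard = if (L.map List.length).sum = 0 then 1 else 0 := by
  have hsum : (L.map List.length).sum = 0 ↔ L.flatten = [] := by
    rw [← List.length_flatten, List.length_eq_zero_iff]
  have heq : ∀ G ∈ completions Bad w n n P, G = P := by
    rintro G ⟨hM, -, -, hG⟩
    ext a b
    rw [hG]
    exact ⟨fun hab => ⟨hab, (hM.1 a b hab).2.1, (hM.1 a b hab).2.2.2⟩, fun hab => hab.1⟩
  simp only [hsum]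
  split_ifs with hL
  · rw [Set.encard_eq_one]
    refine ⟨P, Set.eq_singleton_iff_unique_mem.2 ⟨⟨⟨?_, ?_⟩, h.base, h.free, ?_⟩, heq⟩⟩
    · intro u v huv
      exact ⟨(h.bound u v huv).1, (h.bound u v huv).2, h.bound_right huv⟩
    · intro v h1 h2
      have hv := h.stubs v
      simp only [hL, List.not_mem_nil, h1, h2, true_and, false_iff, not_forall, not_not] at hv
      obtain ⟨a, ha⟩ := hv
      exact ⟨a, ha, fun b hb => h.unique _ _ _ hb ha⟩
    · intro a b
      exact ⟨fun hab => ⟨hab, (h.bound a b hab).2, (h.bound_right hab).2⟩, fun hab => hab.1⟩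
  · rw [Set.encard_eq_zero, Set.eq_empty_iff_forall_notMem]
    intro G hG
    obtain rfl := heq G hG
    obtain ⟨v, hv⟩ := List.exists_mem_of_ne_nil _ hL
    obtain ⟨h1, h2, h3⟩ := (h.stubs v).1 hv
    obtain ⟨a, ha, -⟩ := hG.1.2 v h1 h2
    exact h3 a ha

lemma completions_push (hk : k < n) (hw : ¬ w (k + 1) = true) :
    completions Bad w n k P = completions Bad w n (k + 1) P := by
  ext G
  simp only [completions, Set.mem_ofPred_eq]
  refine and_congr_right fun hM => and_congr_right fun hB => and_congr_right fun _ => ?_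
  refine forall_congr' fun a => forall_congr' fun b => ?_
  have hno : ∀ a b, G.Adj a b → a ≤ k + 1 → b ≤ k + 1 → a ≤ k := by
    intro a b hab ha hb
    by_contra hak
    obtain rfl : a = k + 1 := by omega
    have hne := hab.ne
    exact hw ((hB _ (by omega) hk).2 ⟨b, by omega, hab⟩)
  have : (G.Adj a b ∧ a ≤ k ∧ b ≤ k) ↔ (G.Adj a b ∧ a ≤ k + 1 ∧ b ≤ k + 1) :=
    ⟨fun ⟨h1, h2, h3⟩ => ⟨h1, by omega, by omega⟩,
      fun ⟨h1, h2, h3⟩ => ⟨h1, hno a b h1 h2 h3, hno b a h1.symm h3 h2⟩⟩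
  rw [this]

/-- In a completion of `P`, the vertex `k + 1` is joined to the selected stub of some class. -/
lemma mem_completions_close (S : LinkSystem D Bad sel) (h : PartialState D Bad w k P L)
    (hk : k < n) (hw : w (k + 1) = true) (G : SimpleGraph ℕ) :
    G ∈ completions Bad w n k P ↔ ∃ c ∈ L, c ≠ [] ∧
      G ∈ completions Bad w n (k + 1) (P ⊔ SimpleGraph.edge (sel c) (k + 1)) := by
  constructor
  · rintro ⟨hM, hB, hF, hG⟩
    have huniq : ∀ a b c, G.Adj a b → G.Adj a c → b = c := fun a b c hb hc =>
      (hM.2 a (hM.1 a b hb).1 (hM.1 a b hb).2.1).unique hb hc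
    obtain ⟨j, hjk, hj⟩ := (hB (k + 1) (by omega) hk).1 hw
    have hstub : ∀ a, ¬ P.Adj j a := by
      intro a ha
      have ha' := (hG _ _).1 ha
      have := huniq _ _ _ ha'.1 hj.symm
      omega
    have hjL : j ∈ L.flatten := (h.stubs j).2 ⟨(hM.1 _ _ hj).2.2.1, by omega, hstub⟩
    obtain ⟨c, hc, hjc⟩ := List.mem_flatten.1 hjL
    have hne : c ≠ [] := List.ne_nil_of_mem hjc
    have hsc := S.sel_mem hne
    obtain ⟨hs1, hsk, hsstub⟩ := (h.stubs _).1 (List.mem_flatten_of_mem hc hsc)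
    obtain rfl : j = sel c := by
      by_contra hjs
      have hb : Bad P (k + 1) j (sel c) := S.bad_of_ne_sel (h.class_sorted hc) hjc hjs
        fun u hu v hv huv => (h.link u (List.mem_flatten_of_mem hc hu) v
          (List.mem_flatten_of_mem hc hv) huv).2 ⟨c, hc, hu, hv⟩
      refine hF j (k + 1) (sel c) hj.symm hjk (fun z hz => ?_)
        (S.bad_mono (fun a b _ _ hab => ((hG a b).1 hab).1) hb)
      by_contra hzk
      rcases Nat.lt_or_ge k z with hz' | hz'
      · obtain rfl : z = k + 1 := by omega
        exact hjs (huniq _ _ _ hj hz.symm)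
      · exact hsstub z ((hG _ _).2 ⟨hz, hsk, hz'⟩)
    refine ⟨c, hc, hne, hM, hB, hF, fun a b => ?_⟩
    rw [sup_edge_adj hjk, hG]
    constructor
    · rintro (h' | ⟨rfl, rfl⟩ | ⟨rfl, rfl⟩)
      · exact ⟨h'.1, by omega, by omega⟩
      · exact ⟨hj.symm, by omega, le_rfl⟩
      · exact ⟨hj, le_rfl, by omega⟩
    · rintro ⟨hab, ha, hb⟩
      by_cases hak : a = k + 1
      · subst hak
        exact .inr (.inr ⟨rfl, huniq _ _ _ hab hj⟩)
      · by_cases hbk : b = k + 1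
        · subst hbk
          exact .inr (.inl ⟨huniq _ _ _ hab.symm hj, rfl⟩)
        · exact .inl ⟨hab, by omega, by omega⟩
  · rintro ⟨c, hc, hne, hM, hB, hF, hG⟩
    have hs := (h.stubs _).1 (List.mem_flatten_of_mem hc (S.sel_mem hne))
    refine ⟨hM, hB, hF, fun a b => ?_⟩
    have hG' := hG a b
    rw [sup_edge_adj (by omega)] at hG'
    constructor
    · intro hab
      exact ⟨(hG'.1 (.inl hab)).1, (h.bound _ _ hab).2, (h.bound_right hab).2⟩
    · rintro ⟨hab, ha, hb⟩
      rcases hG'.2 ⟨hab, by omega, by omega⟩ with h' | h' | h'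
      · exact h'
      · omega
      · omega

theorem encard_completions (S : LinkSystem D Bad sel) :
    ∀ (r k : ℕ) (P : SimpleGraph ℕ) (L : List (List ℕ)), k + r = n →
      PartialState D Bad w k P L →
      (completions Bad w n k P).encard = countFrom n w r (L.map List.length) := by
  intro r
  induction r with
  | zero =>
    rintro k P L rfl h
    rw [Nat.add_zero, completions_full h, countFrom]
    split_ifs <;> simp
  | succ r ih =>
    intro k P L hkr h
    have hnr : n - r = k + 1 := by omega
    rw [countFrom, hnr]
    split_ifs with hw
    · let T : Fin (L.map List.length).length → Set (SimpleGraph ℕ) := fun i =>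
        if (L.map List.length)[i] = 0 then ∅
        else completions Bad w n (k + 1)
          (P ⊔ SimpleGraph.edge (sel (L[(i : ℕ)]'(by simpa using i.2))) (k + 1))
      have hTmem : ∀ (G : SimpleGraph ℕ) (i : ℕ) (hi' : i < (L.map List.length).length)
          (hi : i < L.length), G ∈ T ⟨i, hi'⟩ ↔ L[i] ≠ [] ∧
            G ∈ completions Bad w n (k + 1) (P ⊔ SimpleGraph.edge (sel L[i]) (k + 1)) := by
        intro G i hi' hi
        by_cases h0 : L[i] = [] <;> simp [T, h0]
      have hT : completions Bad w n k P = ⋃ i, T i := by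
        ext G
        rw [mem_completions_close S h (by omega) hw, Set.mem_iUnion]
        constructor
        · rintro ⟨c, hc, hne, hG⟩
          obtain ⟨i, hi, rfl⟩ := List.mem_iff_getElem.1 hc
          exact ⟨⟨i, by simpa using hi⟩, (hTmem G i _ hi).2 ⟨hne, hG⟩⟩
        · rintro ⟨⟨i, hi'⟩, hG⟩
          have hi : i < L.length := by simpa using hi'
          exact ⟨L[i], List.getElem_mem hi, (hTmem G i hi' hi).1 hG⟩
      have hdisj : Pairwise (Function.onFun Disjoint T) := by
        rintro ⟨i, hi'⟩ ⟨j, hj'⟩ hij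
        rw [Function.onFun, Set.disjoint_left]
        intro G hi hj
        have hiL : i < L.length := by simpa using hi'
        have hjL : j < L.length := by simpa using hj'
        obtain ⟨hni, hM, -, -, hGi⟩ := (hTmem G i hi' hiL).1 hi
        obtain ⟨hnj, -, -, -, hGj⟩ := (hTmem G j hj' hjL).1 hj
        have hsi := S.sel_mem hni
        have hsj := S.sel_mem hnj
        have hik := (h.stubs _).1 (List.mem_flatten_of_mem (List.getElem_mem hiL) hsi)
        have hjk := (h.stubs _).1 (List.mem_flatten_of_mem (List.getElem_mem hjL) hsj)
        have ei := ((hGi (k + 1) (sel L[i])).1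
          ((sup_edge_adj (by omega) _ _).2 (.inr (.inr ⟨rfl, rfl⟩)))).1
        have ej := ((hGj (k + 1) (sel L[j])).1
          ((sup_edge_adj (by omega) _ _).2 (.inr (.inr ⟨rfl, rfl⟩)))).1
        have heq := (hM.2 (k + 1) (by omega) (by omega)).unique ei ej
        have hpw := (List.pairwise_flatten.1 h.sorted).2
        rw [List.pairwise_iff_getElem] at hpw
        rcases Nat.lt_or_gt_of_ne (fun hh => hij (Fin.ext hh) : i ≠ j) with hlt | hlt
        · exact absurd (hpw i j hiL hjL hlt _ hsi _ hsj) (by omega)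
        · exact absurd (hpw j i hjL hiL hlt _ hsj _ hsi) (by omega)
      rw [hT, Set.encard_iUnion_of_finite hdisj, finsum_eq_sum_of_fintype, Nat.cast_sum]
      refine Finset.sum_congr rfl fun i _ => ?_
      simp only [T]
      split_ifs with h0
      · simp
      · obtain ⟨i, hi'⟩ := i
        have hi : i < L.length := by simpa using hi'
        have hne : L[i] ≠ [] := by simpa using h0
        have hL : L = L.take i ++ L[i] :: L.drop (i + 1) := by
          rw [List.getElem_cons_drop, List.take_append_drop]
        have h' := h
        rw [hL] at h'
        simp only [ih (k + 1) _ _ (by omega) (h'.close S hne hw)]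
        congr 2
        have hpos : 0 < L[i].length := List.length_pos_iff.2 hne
        simp only [List.map_cons, List.length_append, List.length_flatten,
          List.length_erase_of_mem (S.sel_mem hne), ← List.map_take, ← List.map_drop,
          List.cons.injEq, and_true, List.take_succ_eq_append_getElem hi, List.map_append,
          List.sum_append, List.map_nil, List.sum_singleton]
        omega
    · rw [completions_push (by omega) hw, ih (k + 1) P _ (by omega) (h.push S hw)]
      simp

/-- The number of matchings free of bad configurations depends only on the base. -/
theorem card_badFree (S : LinkSystem D Bad sel) (n : ℕ) (w : ℕ → Bool) :
    Nat.card {G : SimpleGraph ℕ // IsMatchingOn n G ∧ HasBase n G w ∧ BadFree Bad G} =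
      countFrom n w n [] := by
  have h := encard_completions (w := w) S n 0 ⊥ [] (Nat.zero_add n) (.empty (D := D) (Bad := Bad))
  have hset : completions Bad w n 0 ⊥ =
      {G | IsMatchingOn n G ∧ HasBase n G w ∧ BadFree Bad G} := by
    ext G
    simp only [completions, Set.mem_ofPred_eq]
    refine and_congr_right fun hM => and_congr_right fun _ => and_iff_left fun a b => ?_
    simp only [SimpleGraph.bot_adj, false_iff]
    rintro ⟨hab, ha, -⟩
    have := hM.1 a b hab
    omega
  rw [hset] at h
  change Nat.card {G | IsMatchingOn n G ∧ HasBase n G w ∧ BadFree Bad G} = _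
  rw [Nat.card_coe_set_eq, Set.ncard_def, h]
  simp

end Counting

/-- Some edge of `G` ending before `r` spans both `u` and `v`, where `u < v`. -/
def Spanned (G : SimpleGraph ℕ) (r u v : ℕ) : Prop :=
  u < v ∧ ∃ x y, G.Adj x y ∧ x < u ∧ v < y ∧ y < r

/-- The pairs `(u, y₁), (y₁, y₂), …` of consecutive right ends (starting with `u`) along chains
`{x₁, y₁}, {x₂, y₂}, …` of edges of `G` ending before `r` such that
`x₁ < u < x₂ < y₁ < x₃ < y₂ < ⋯`. -/
inductive CrossChain (G : SimpleGraph ℕ) (r u : ℕ) : ℕ → ℕ → Prop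
  | base {x y : ℕ} : G.Adj x y → x < u → u < y → y < r → CrossChain G r u u y
  | step {a y x' y' : ℕ} : CrossChain G r u a y → G.Adj x' y' → a < x' → x' < y → y < y' →
      y' < r → CrossChain G r u y y'

/-- Some crossing chain of edges of `G` ending before `r` leads from `u` to `v`. -/
def Chained (G : SimpleGraph ℕ) (r u v : ℕ) : Prop :=
  ∃ a y, CrossChain G r u a y ∧ a < v ∧ v < y

namespace CrossChain

variable {G H : SimpleGraph ℕ} {r r' u a y : ℕ}

lemma bounds (h : CrossChain G r u a y) : 0 < u ∧ u ≤ a ∧ a < y ∧ y < r := by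
  induction h <;> omega

lemma mono (hGH : ∀ a b, a < b → b < r → G.Adj a b → b < r' ∧ H.Adj a b)
    (h : CrossChain G r u a y) : CrossChain H r' u a y := by
  induction h with
  | base h1 h2 h3 h4 =>
    obtain ⟨h5, h6⟩ := hGH _ _ (by omega) h4 h1
    exact .base h6 h2 h3 h5
  | step _ h1 h2 h3 h4 h5 ih =>
    obtain ⟨h6, h7⟩ := hGH _ _ (by omega) h5 h1
    exact .step ih h7 h2 h3 h4 h6

/-- A chain using a new last edge `{s, k + 1}` uses it only at its end. -/
lemma of_sup_edge {k s : ℕ} (hb : ∀ a b, G.Adj a b → 1 ≤ a ∧ a ≤ k) (hs : s ≤ k)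
    (h : CrossChain (G ⊔ SimpleGraph.edge s (k + 1)) (k + 2) u a y) :
    CrossChain G (k + 1) u a y ∨ (y = k + 1 ∧ ((a = u ∧ s < u) ∨
      ∃ a', CrossChain G (k + 1) u a' a ∧ a' < s ∧ s < a)) := by
  induction h with
  | base h1 h2 h3 h4 =>
    rcases (sup_edge_adj (by omega) _ _).1 h1 with h1 | ⟨rfl, rfl⟩ | h1
    · have := hb _ _ h1.symm
      exact .inl (.base h1 h2 h3 (by omega))
    · exact .inr ⟨rfl, .inl ⟨rfl, h2⟩⟩
    · omega
  | step h0 h1 h2 h3 h4 h5 ih =>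
    rcases ih with ih | ⟨rfl, -⟩
    · rcases (sup_edge_adj (by omega) _ _).1 h1 with h1 | ⟨rfl, rfl⟩ | h1
      · have := hb _ _ h1.symm
        exact .inl (.step ih h1 h2 h3 h4 (by omega))
      · exact .inr ⟨rfl, .inr ⟨_, ih, h2, h3⟩⟩
      · have := ih.bounds; omega
    · omega

end CrossChain

lemma adj_of_adj_sup_edge {G : SimpleGraph ℕ} {k s : ℕ} :
    ∀ a b, a < b → b < k + 1 → G.Adj a b →
      b < k + 2 ∧ (G ⊔ SimpleGraph.edge s (k + 1)).Adj a b :=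
  fun _ _ _ hbk hab => ⟨by omega, Or.inl hab⟩

lemma getLastD_le {c : List ℕ} (hc : c.Pairwise (· > ·)) {t : ℕ} (ht : t ∈ c) :
    c.getLastD 0 ≤ t := by
  induction c using List.reverseRecOn with
  | nil => simp at ht
  | append_singleton c a _ =>
    simp only [List.pairwise_append, List.mem_singleton, forall_eq] at hc
    simp only [List.getLastD_concat]
    rcases List.mem_append.1 ht with ht | ht
    · exact (hc.2.2 t ht).le
    · simp_all

lemma le_headD {c : List ℕ} (hc : c.Pairwise (· > ·)) {t : ℕ} (ht : t ∈ c) :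
    t ≤ c.headD 0 := by
  cases c with
  | nil => simp at ht
  | cons a c =>
    simp only [List.pairwise_cons] at hc
    rcases List.mem_cons.1 ht with rfl | ht
    · simp
    · exact (hc.1 t ht).le

lemma getLastD_mem {c : List ℕ} (hc : c ≠ []) : c.getLastD 0 ∈ c := by
  rw [List.getLastD_eq_getLast?, List.getLast?_eq_some_getLast hc]
  exact List.getLast_mem hc

lemma headD_mem {c : List ℕ} (hc : c ≠ []) : c.headD 0 ∈ c := by
  cases c <;> simp_all

theorem linkSystem_spanned :
    LinkSystem Spanned (fun G r s t => Spanned G r t s) (fun c => c.getLastD 0) where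
  lt := by
    rintro G r u v ⟨h, x, y, -, h1, h2, h3⟩
    omega
  mono := by
    rintro G H r r' u v hGH ⟨h, x, y, h1, h2, h3, h4⟩
    obtain ⟨h5, h6⟩ := hGH x y (by omega) h4 h1
    exact ⟨h, x, y, h6, h2, h3, h5⟩
  bad_mono := by
    rintro G H r s t hGH ⟨h, x, y, h1, h2, h3, h4⟩
    exact ⟨h, x, y, hGH x y (by omega) h4 h1, h2, h3, h4⟩
  bad_link := .inr
  close := by
    intro G k s u v hb hs hv huv hu _ hbad
    constructor
    · rintro ⟨-, x, y, h1, h2, h3, h4⟩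
      rcases (sup_edge_adj (by omega) _ _).1 h1 with h1 | ⟨rfl, rfl⟩ | h1
      · have := hb _ _ h1.symm
        exact .inl ⟨huv, x, y, h1, h2, h3, by omega⟩
      · exact .inr (.inl h2)
      · omega
    · rintro (⟨-, x, y, h1, h2, h3, h4⟩ | h | ⟨-, -, h⟩)
      · exact ⟨huv, x, y, Or.inl h1, h2, h3, by omega⟩
      · exact ⟨huv, s, k + 1, (sup_edge_adj (by omega) _ _).2 (.inr (.inl ⟨rfl, rfl⟩)), h,
          by omega, by omega⟩
      · exact absurd h hbad
  sel_mem := getLastD_mem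
  sel_not_bad := fun hc ht hb => absurd hb.1 (getLastD_le hc ht).not_gt
  bad_of_ne_sel := fun hc hs hne h =>
    h _ (getLastD_mem (List.ne_nil_of_mem hs)) _ hs (lt_of_le_of_ne (getLastD_le hc hs) hne.symm)

theorem linkSystem_chained : LinkSystem Chained Chained (fun c => c.headD 0) where
  lt := by
    rintro G r u v ⟨a, y, h, h1, h2⟩
    have := h.bounds
    omega
  mono := by
    rintro G H r r' u v hGH ⟨a, y, h, h1, h2⟩
    exact ⟨a, y, h.mono hGH, h1, h2⟩
  bad_mono := by
    rintro G H r s t hGH ⟨a, y, h, h1, h2⟩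
    exact ⟨a, y, h.mono fun a b hab hbr h => ⟨hbr, hGH a b hab hbr h⟩, h1, h2⟩
  bad_link := .inl
  close := by
    intro G k s u v hb hs hv huv hu hvs _
    have hnew : (G ⊔ SimpleGraph.edge s (k + 1)).Adj s (k + 1) :=
      (sup_edge_adj (by omega) _ _).2 (.inr (.inl ⟨rfl, rfl⟩))
    constructor
    · rintro ⟨a, y, h, h1, h2⟩
      rcases h.of_sup_edge hb hs with h | ⟨rfl, ⟨rfl, h3⟩ | ⟨a', h, h3, h4⟩⟩
      · exact .inl ⟨a, y, h, h1, h2⟩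
      · exact .inr (.inl h3)
      · have := h.bounds
        exact .inr (.inr ⟨by omega, by omega, a', a, h, h3, h4⟩)
    · rintro (⟨a, y, h, h1, h2⟩ | h | ⟨-, hsv, a, y, h, h1, h2⟩)
      · exact ⟨a, y, h.mono adj_of_adj_sup_edge, h1, h2⟩
      · exact ⟨u, k + 1, .base hnew h (by omega) (by omega), huv, by omega⟩
      · have hyk := h.bounds
        have h' := h.mono (adj_of_adj_sup_edge (s := s))
        rcases lt_trichotomy v y with hvy | rfl | hvy
        · exact ⟨a, y, h', by omega, hvy⟩
        · exfalso
          cases h with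
          | base h _ _ _ => exact hvs _ h.symm
          | step _ h _ _ _ _ => exact hvs _ h.symm
        · exact ⟨y, k + 1, .step h' hnew h1 h2 (by omega) (by omega), hvy, by omega⟩
  sel_mem := headD_mem
  sel_not_bad := by
    rintro G r c t hc ht ⟨a, y, h, h1, h2⟩
    have := h.bounds
    have := le_headD hc ht
    omega
  bad_of_ne_sel := fun hc hs hne h =>
    h _ hs _ (headD_mem (List.ne_nil_of_mem hs)) (lt_of_le_of_ne (le_headD hc hs) hne)

/-- A prefix of a pattern copy of some `C_k` which realizes a crossing chain. -/
lemma CrossChain.exists_strictMono {G : SimpleGraph ℕ} {r u a y : ℕ} (hG : ∀ a b, G.Adj a b → 0 < a)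
    (h : CrossChain G r u a y) : ∃ p, 1 ≤ p ∧ ∃ f : ℕ → ℕ, StrictMono f ∧ f 2 = u ∧
      f (2 * p) = a ∧ G.Adj (f (2 * p - 1)) y ∧
      ∀ i, 1 ≤ i → i < p → G.Adj (f (2 * i - 1)) (f (2 * i + 2)) := by
  induction h with
  | @base x y h1 h2 h3 h4 =>
    have := hG _ _ h1
    refine ⟨1, le_rfl, fun i => if i = 0 then 0 else if i = 1 then x else u + (i - 2),
      strictMono_nat_of_lt_succ fun i => ?_, by simp, by simp, by simpa using h1, by omega⟩
    repeat' split
    all_goals omega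
  | @step a y x' y' h0 h1 h2 h3 h4 h5 ih =>
    obtain ⟨p, hp, f, hf, hf2, hfp, hadj, hchain⟩ := ih
    refine ⟨p + 1, by omega, fun i => if i ≤ 2 * p then f i else if i = 2 * p + 1 then x' else
      y + (i - (2 * p + 2)), strictMono_nat_of_lt_succ fun i => ?_, ?_, ?_, ?_, ?_⟩
    · have h6 := hf (Nat.lt_succ_self i)
      have h7 : i = 2 * p → f i = a := by rintro rfl; exact hfp
      repeat' split
      all_goals omega
    · simp only [if_pos (show 2 ≤ 2 * p by omega), hf2]
    · simp only [if_neg (show ¬ 2 * (p + 1) ≤ 2 * p by omega),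
        if_neg (show ¬ 2 * (p + 1) = 2 * p + 1 by omega)]
      omega
    · simp only [if_neg (show ¬ 2 * (p + 1) - 1 ≤ 2 * p by omega),
        if_pos (show 2 * (p + 1) - 1 = 2 * p + 1 by omega), h1]
    · intro i hi1 hi2
      beta_reduce
      rw [if_pos (by omega)]
      by_cases hip : i = p
      · subst hip
        rw [if_neg (by omega), if_neg (by omega), Nat.sub_self]
        exact hadj
      · rw [if_pos (by omega)]
        exact hchain i hi1 (by omega)

section Patterns

variable {n : ℕ} {G : SimpleGraph ℕ}

lemma IsMatchingOn.unique (hM : IsMatchingOn n G) {a b c : ℕ} (hb : G.Adj a b) (hc : G.Adj a c) :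
    b = c :=
  (hM.2 a (hM.1 a b hb).1 (hM.1 a b hb).2.1).unique hb hc

theorem badFree_spanned_iff (hM : IsMatchingOn n G) :
    BadFree (fun G r s t => Spanned G r t s) G ↔ ¬ ContainsPat G M132 := by
  constructor
  · rintro hF ⟨f, hf, hadj⟩
    have h14 : G.Adj (f 1) (f 4) := hadj 1 4 (by simp [M132])
    have h26 : G.Adj (f 2) (f 6) := hadj 2 6 (by simp [M132])
    have h35 : G.Adj (f 3) (f 5) := hadj 3 5 (by simp [M132])
    refine hF (f 3) (f 5) (f 2) h35 (hf (by norm_num)) (fun z hz => ?_)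
      ⟨hf (by norm_num), f 1, f 4, h14, hf (by norm_num), hf (by norm_num), hf (by norm_num)⟩
    rw [hM.unique hz h26]
    exact hf (by norm_num)
  · rintro hC s r t hsr hlt ht ⟨hts, x, y, hxy, hxt, hsy, hyr⟩
    have hb := hM.1 _ _ hsr
    have hx := hM.1 _ _ hxy
    obtain ⟨z, hz, -⟩ := hM.2 t (by omega) (by omega)
    have hrz := ht z hz
    refine hC ⟨fun i => if i = 0 then 0 else if i = 1 then x else if i = 2 then t else
      if i = 3 then s else if i = 4 then y else if i = 5 then r else z + (i - 6),
      strictMono_nat_of_lt_succ fun i => ?_, ?_⟩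
    · repeat' split
      all_goals omega
    · intro u v huv
      simp only [M132, SimpleGraph.fromRel_adj, List.mem_cons, Prod.mk.injEq, List.not_mem_nil,
        or_false] at huv
      rcases huv.2 with (⟨rfl, rfl⟩ | ⟨rfl, rfl⟩ | ⟨rfl, rfl⟩) |
        (⟨rfl, rfl⟩ | ⟨rfl, rfl⟩ | ⟨rfl, rfl⟩)
      · simpa using hxy
      · simpa using hz
      · simpa using hsr
      · simpa using hxy.symm
      · simpa using hz.symm
      · simpa using hsr.symm

theorem badFree_chained_iff (hM : IsMatchingOn n G) :
    BadFree Chained G ↔ ∀ k, 3 ≤ k → ¬ ContainsPat G (Ck k) := by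
  constructor
  · rintro hF k hk ⟨f, hf, hadj⟩
    have hlast : G.Adj (f 2) (f (2 * k - 1)) := by
      refine hadj _ _ ?_
      simp only [Ck, SimpleGraph.fromRel_adj]
      exact ⟨by omega, .inl (.inr (by simp))⟩
    have hedge : ∀ i, 1 ≤ i → i < k → G.Adj (f (2 * i - 1)) (f (2 * i + 2)) := by
      intro i hi hik
      refine hadj _ _ ?_
      simp only [Ck, SimpleGraph.fromRel_adj]
      exact ⟨by omega, .inl (.inl ⟨i, hi, hik, rfl, rfl⟩)⟩
    have hchain : ∀ p, p + 3 ≤ k →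
        CrossChain G (f (2 * k - 1)) (f 2) (f (2 * p + 2)) (f (2 * p + 4)) := by
      intro p
      induction p with
      | zero =>
        intro hp
        exact .base (hedge 1 le_rfl (by omega)) (hf (by omega)) (hf (by omega)) (hf (by omega))
      | succ p ih =>
        intro hp
        exact .step (ih (by omega)) (hedge (p + 2) (by omega) (by omega)) (hf (by omega))
          (hf (by omega)) (hf (by omega)) (hf (by omega))
    obtain ⟨p, rfl⟩ : ∃ p, k = p + 3 := ⟨k - 3, by omega⟩
    refine hF _ _ (f (2 * p + 3)) hlast (hf (by omega)) (fun z hz => ?_)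
      ⟨_, _, hchain p le_rfl, hf (by omega), hf (by omega)⟩
    rw [hM.unique hz (hedge (p + 2) (by omega) (by omega))]
    exact hf (by omega)
  · rintro hC s r t hsr hlt ht ⟨a, y, hch, hat, hty⟩
    have hb := hM.1 _ _ hsr
    have hbd := hch.bounds
    obtain ⟨z, hz, -⟩ := hM.2 t (by omega) (by omega)
    have hrz := ht z hz
    obtain ⟨p, hp, f, hf, hf2, hfp, hadj, hchain⟩ :=
      hch.exists_strictMono fun a b hab => (hM.1 a b hab).1
    let g : ℕ → ℕ := fun i => if i ≤ 2 * p then f i else if i = 2 * p + 1 then t else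
      if i = 2 * p + 2 then y else if i = 2 * p + 3 then r else z + (i - (2 * p + 4))
    have hg0 : ∀ i, i ≤ 2 * p → g i = f i := fun i hi => if_pos hi
    have hg1 : g (2 * p + 1) = t := by simp [g]
    have hg2 : g (2 * p + 2) = y := by simp [g]
    have hg3 : g (2 * p + 3) = r := by simp [g]
    have hg4 : g (2 * p + 4) = z := by simp [g]
    have hrel : ∀ u v, ((∃ i, 1 ≤ i ∧ i < p + 2 ∧ u = 2 * i - 1 ∧ v = 2 * i + 2) ∨
        (u = 2 ∧ v = 2 * (p + 2) - 1)) → G.Adj (g u) (g v) := by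
      rintro u v (⟨i, hi1, hi2, rfl, rfl⟩ | ⟨rfl, rfl⟩)
      · rcases lt_trichotomy i p with hip | rfl | hip
        · rw [hg0 _ (by omega), hg0 _ (by omega)]
          exact hchain i hi1 hip
        · rw [hg0 _ (by omega), hg2]
          exact hadj
        · obtain rfl : i = p + 1 := by omega
          rw [show 2 * (p + 1) - 1 = 2 * p + 1 by omega, show 2 * (p + 1) + 2 = 2 * p + 4 by omega,
            hg1, hg4]
          exact hz
      · rw [hg0 _ (by omega), hf2, show 2 * (p + 2) - 1 = 2 * p + 3 by omega, hg3]
        exact hsr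
    refine hC (p + 2) (by omega) ⟨g, strictMono_nat_of_lt_succ fun i => ?_, fun u v huv => ?_⟩
    · have h6 := hf (Nat.lt_succ_self i)
      have h7 : i = 2 * p → f i = a := by rintro rfl; exact hfp
      simp only [g]
      repeat' split
      all_goals omega
    · simp only [Ck, SimpleGraph.fromRel_adj] at huv
      rcases huv.2 with h | h
      · exact hrel u v h
      · exact (hrel v u h).symm

end Patterns

/-- `g(m,w,𝒞) = g(m,w,M_132)` for every positive `m` and Dyck word `w`
of length `2m`, where `𝒞 = {C_k : k ≥ 3}`. -/
theorem stmt0 (m : ℕ) (hm : 0 < m) (w : ℕ → Bool) (hw : IsDyckWord (2*m) w) :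
    Nat.card {G : SimpleGraph ℕ // IsMatchingOn (2*m) G ∧ HasBase (2*m) G w ∧
      ∀ k : ℕ, 3 ≤ k → ¬ ContainsPat G (Ck k)} =
    Nat.card {G : SimpleGraph ℕ // IsMatchingOn (2*m) G ∧ HasBase (2*m) G w ∧
      ¬ ContainsPat G M132} := by
  have hC := card_badFree linkSystem_chained (2 * m) w
  have hM := card_badFree linkSystem_spanned (2 * m) w
  rw [← hM] at hC
  refine Eq.trans (Nat.card_congr (Equiv.subtypeEquivRight fun G => ?_)) (hC.trans
    (Nat.card_congr (Equiv.subtypeEquivRight fun G => ?_)))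
  · exact and_congr_right fun h => and_congr_right fun _ => (badFree_chained_iff h).symm
  · exact and_congr_right fun h => and_congr_right fun _ => badFree_spanned_iff h
end

section
/- For every positive integer m and every Dyck word w of length 2m, g(m,w,M_132) = g(m,w,M_213); i.e., the number of matchings on [2m] with base w avoiding M_132 equals the number of matchings on [2m] with base w avoiding M_213. -/
/-- The state obtained by closing an open vertex with `k` newer open vertices, where `s` lists
the flags of the older ones. -/
def fillState : ℕ → List Bool → List Bool
  | 0, s => s
  | k + 1, s => List.replicate k false ++ true :: s

/-- The sum of `F` over all states reachable by closing an available vertex. States are listed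
from the newest open vertex to the oldest, `true` marks the available vertices, and `k` further
newer vertices precede the list. -/
def closeSum (F : List Bool → ℕ) : ℕ → List Bool → ℕ
  | _, [] => 0
  | k, b :: s => (if b then F (fillState k s) else 0) + closeSum F (k + 1) s

/-- The sum of `F` over all states reached by reading a word, with multiplicities. -/
def runSum (F : List Bool → ℕ) : List Bool → List Bool → ℕ
  | [], s => F s
  | false :: u, s => runSum F u (true :: s)
  | true :: u, s => closeSum (runSum F u) 0 s

/-- Number of pairs of label increments compatible with two states, with slack `z`. -/
def slackCount : ℕ → List Bool → List Bool → ℕ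
  | 0, [], [] => 1
  | z + 1, b :: s, c :: t =>
      slackCount (z + 2) s t + (if b then slackCount (z + 1) s t else 0) +
        (if c then slackCount (z + 1) s t else 0) + (if b && c then slackCount z s t else 0)
  | _, _, _ => 0

/-- The pairing between states read from the left and states read from the right. -/
def statePairing (s t : List Bool) : ℕ :=
  if s = [] then (if t = [] then 1 else 0) else slackCount 1 s t

theorem slackCount_succ_nil_left (z : ℕ) (t : List Bool) : slackCount (z + 1) [] t = 0 := by
  simp [slackCount]

theorem slackCount_succ_nil_right (z : ℕ) (s : List Bool) : slackCount (z + 1) s [] = 0 := by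
  simp [slackCount]

theorem slackCount_zero_cons_left (b : Bool) (s t : List Bool) :
    slackCount 0 (b :: s) t = 0 := by
  simp [slackCount]

theorem slackCount_cons_cons (z : ℕ) (b c : Bool) (s t : List Bool) :
    slackCount (z + 1) (b :: s) (c :: t) =
      slackCount (z + 2) s t + (if b then slackCount (z + 1) s t else 0) +
        (if c then slackCount (z + 1) s t else 0) + (if b && c then slackCount z s t else 0) := by
  simp [slackCount]

theorem slackCount_comm (s t : List Bool) (z : ℕ) : slackCount z s t = slackCount z t s := by
  induction s generalizing t z with
  | nil =>
    rcases t with _ | ⟨c, t⟩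
    · rfl
    · cases z <;> simp [slackCount]
  | cons b s ih =>
    rcases t with _ | ⟨c, t⟩
    · cases z <;> simp [slackCount]
    · rcases z with _ | z
      · simp [slackCount]
      · rw [slackCount_cons_cons, slackCount_cons_cons, ih, ih, ih]
        cases b <;> cases c <;> simp

theorem statePairing_comm (s t : List Bool) : statePairing s t = statePairing t s := by
  rcases s with _ | ⟨b, s⟩ <;> rcases t with _ | ⟨c, t⟩ <;>
    simp [statePairing, slackCount_succ_nil_right]
  exact slackCount_comm _ _ _

theorem closeSum_zero (k : ℕ) (s : List Bool) : closeSum (fun _ => 0) k s = 0 := by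
  induction s generalizing k with
  | nil => rfl
  | cons b s ih => simp [closeSum, ih]

theorem closeSum_add (F H : List Bool → ℕ) (k : ℕ) (s : List Bool) :
    closeSum (fun t => F t + H t) k s = closeSum F k s + closeSum H k s := by
  induction s generalizing k with
  | nil => rfl
  | cons b s ih =>
    simp only [closeSum, ih]
    split_ifs <;> omega

theorem closeSum_ite (P : Prop) [Decidable P] (F : List Bool → ℕ) (k : ℕ) (s : List Bool) :
    closeSum (fun t => if P then F t else 0) k s = if P then closeSum F k s else 0 := by
  split_ifs
  · rfl
  · exact closeSum_zero k s

theorem closeSum_add_two (F : List Bool → ℕ) (k : ℕ) (s : List Bool) :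
    closeSum F (k + 2) s = closeSum (fun t => F (false :: t)) (k + 1) s := by
  induction s generalizing k with
  | nil => rfl
  | cons b s ih =>
    simp only [closeSum]
    rw [ih (k + 1)]
    simp [fillState, List.replicate_succ]

theorem closeSum_comm (H : List Bool → List Bool → ℕ) (k l : ℕ) (s t : List Bool) :
    closeSum (fun s' => closeSum (H s') l t) k s =
      closeSum (fun t' => closeSum (fun s' => H s' t') k s) l t := by
  induction s generalizing k with
  | nil => exact (closeSum_zero l t).symm
  | cons b s ih => simp only [closeSum, closeSum_add, closeSum_ite, ih]

theorem runSum_closeSum (H : List Bool → List Bool → ℕ) (k : ℕ) (s u t : List Bool) :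
    runSum (fun t' => closeSum (fun s' => H s' t') k s) u t =
      closeSum (fun s' => runSum (H s') u t) k s := by
  induction u generalizing t with
  | nil => rfl
  | cons c u ih =>
    cases c
    · exact ih _
    · have : runSum (fun t' => closeSum (fun s' => H s' t') k s) u =
          fun t => closeSum (fun s' => runSum (H s') u t) k s := funext ih
      simp only [runSum, this]
      exact (closeSum_comm _ _ _ _ _).symm

theorem runSum_append (F : List Bool → ℕ) (u v s : List Bool) :
    runSum F (u ++ v) s = runSum (runSum F v) u s := by
  induction u generalizing s with
  | nil => rfl
  | cons c u ih =>
    cases c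
    · exact ih _
    · have : runSum F (u ++ v) = runSum (runSum F v) u := funext ih
      simp only [List.cons_append, runSum, this]

theorem closeSum_slackCount (s t : List Bool) (z : ℕ) :
    closeSum (slackCount (z + 1) s) 1 t = slackCount (z + 2) s t + slackCount (z + 1) s t := by
  induction t generalizing s z with
  | nil => simp [closeSum, slackCount_succ_nil_right]
  | cons c t ih =>
    rcases s with _ | ⟨b, s⟩
    · have : slackCount (z + 1) [] = fun _ => 0 := funext (slackCount_succ_nil_left z)
      simp [this, closeSum_zero, slackCount_succ_nil_left]
    · rw [closeSum, closeSum_add_two]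
      simp only [slackCount_cons_cons, fillState, List.replicate_zero, List.nil_append]
      simp only [Bool.and_false, Bool.false_eq_true, if_false, add_zero, closeSum_add,
        closeSum_ite, ih]
      cases b <;> cases c <;> simp [Nat.add_assoc] <;> omega

theorem statePairing_cons (b : Bool) (s t : List Bool) :
    statePairing (b :: s) t = slackCount 1 (b :: s) t := by
  simp [statePairing]

theorem closeSum_statePairing (s t : List Bool) :
    closeSum (statePairing s) 0 t = statePairing (true :: s) t := by
  rcases t with _ | ⟨c, t⟩
  · simp [closeSum, statePairing, slackCount_succ_nil_right]
  · rcases s with _ | ⟨b, s⟩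
    · have h : closeSum (statePairing []) 1 t = 0 := by
        have : ∀ (k : ℕ), closeSum (statePairing []) (k + 1) t = 0 := by
          induction t with
          | nil => intro k; rfl
          | cons d t ih => intro k; simp [closeSum, ih, fillState, statePairing]
        exact this 0
      rw [closeSum, h]
      rcases t with _ | ⟨d, t⟩ <;> cases c <;> simp [statePairing, slackCount, fillState]
    · have h : statePairing (b :: s) = slackCount 1 (b :: s) := by
        funext u; exact statePairing_cons b s u
      rw [closeSum, h, closeSum_slackCount]
      rw [statePairing_cons, slackCount_cons_cons, slackCount_zero_cons_left]
      simp only [fillState]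
      cases c
      · simp
      · simp; omega

theorem runSum_statePairing (u s t : List Bool) :
    runSum (fun s' => statePairing s' t) u s =
      runSum (statePairing s) (u.reverse.map not) t := by
  induction u generalizing s with
  | nil => rfl
  | cons c u ih =>
    rw [List.reverse_cons, List.map_append, runSum_append]
    cases c
    · simp only [runSum, List.map_cons, List.map_nil, Bool.not_false]
      rw [ih]
      congr 1
      funext t'
      exact (closeSum_statePairing s t').symm
    · simp only [runSum, List.map_cons, List.map_nil, Bool.not_true]
      rw [funext ih, ← runSum_closeSum]
      congr 1
      funext t'
      rw [statePairing_comm, ← closeSum_statePairing]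
      exact congrArg (closeSum · 0 s) (funext fun s' => statePairing_comm s' t')

/-- Reading a word backwards, with its letters exchanged, gives the same count. -/
theorem runSum_reverse (u : List Bool) :
    runSum (fun s => statePairing s []) (u.reverse.map not) [] =
      runSum (fun s => statePairing s []) u [] := by
  rw [runSum_statePairing u]
  congr 1
  funext t
  exact statePairing_comm t []

theorem containsPat_M132_iff {G : SimpleGraph ℕ} (hG : ∀ u v, G.Adj u v → 1 ≤ u) :
    ContainsPat G M132 ↔ ∃ a b c d e g : ℕ, a < b ∧ b < c ∧ c < d ∧ d < e ∧ e < g ∧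
      G.Adj a d ∧ G.Adj b g ∧ G.Adj c e := by
  constructor
  · rintro ⟨f, hf, h⟩
    exact ⟨f 1, f 2, f 3, f 4, f 5, f 6, hf (by norm_num), hf (by norm_num), hf (by norm_num),
      hf (by norm_num), hf (by norm_num), h _ _ (by simp [M132]), h _ _ (by simp [M132]),
      h _ _ (by simp [M132])⟩
  · rintro ⟨a, b, c, d, e, g, hab, hbc, hcd, hde, heg, h1, h2, h3⟩
    have ha := hG _ _ h1
    let f : ℕ → ℕ := fun n => match n with
      | 0 => 0 | 1 => a | 2 => b | 3 => c | 4 => d | 5 => e | k + 6 => g + k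
    refine ⟨f, strictMono_nat_of_lt_succ fun n => ?_, fun u v huv => ?_⟩
    · rcases n with _ | _ | _ | _ | _ | _ | n <;> simp only [f] <;> omega
    · simp only [M132, SimpleGraph.fromRel_adj, List.mem_cons, Prod.mk.injEq, List.not_mem_nil,
        or_false] at huv
      rcases huv with ⟨-, (⟨rfl, rfl⟩ | ⟨rfl, rfl⟩ | ⟨rfl, rfl⟩) |
        (⟨rfl, rfl⟩ | ⟨rfl, rfl⟩ | ⟨rfl, rfl⟩)⟩
      exacts [h1, h2, h3, h1.symm, h2.symm, h3.symm]

theorem containsPat_M213_iff {G : SimpleGraph ℕ} (hG : ∀ u v, G.Adj u v → 1 ≤ u) :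
    ContainsPat G M213 ↔ ∃ a b c d e g : ℕ, a < b ∧ b < c ∧ c < d ∧ d < e ∧ e < g ∧
      G.Adj a e ∧ G.Adj b d ∧ G.Adj c g := by
  constructor
  · rintro ⟨f, hf, h⟩
    exact ⟨f 1, f 2, f 3, f 4, f 5, f 6, hf (by norm_num), hf (by norm_num), hf (by norm_num),
      hf (by norm_num), hf (by norm_num), h _ _ (by simp [M213]), h _ _ (by simp [M213]),
      h _ _ (by simp [M213])⟩
  · rintro ⟨a, b, c, d, e, g, hab, hbc, hcd, hde, heg, h1, h2, h3⟩
    have ha := hG _ _ h1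
    let f : ℕ → ℕ := fun n => match n with
      | 0 => 0 | 1 => a | 2 => b | 3 => c | 4 => d | 5 => e | k + 6 => g + k
    refine ⟨f, strictMono_nat_of_lt_succ fun n => ?_, fun u v huv => ?_⟩
    · rcases n with _ | _ | _ | _ | _ | _ | n <;> simp only [f] <;> omega
    · simp only [M213, SimpleGraph.fromRel_adj, List.mem_cons, Prod.mk.injEq, List.not_mem_nil,
        or_false] at huv
      rcases huv with ⟨-, (⟨rfl, rfl⟩ | ⟨rfl, rfl⟩ | ⟨rfl, rfl⟩) |
        (⟨rfl, rfl⟩ | ⟨rfl, rfl⟩ | ⟨rfl, rfl⟩)⟩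
      exacts [h1, h2, h3, h1.symm, h2.symm, h3.symm]

/-- The reversal of `{1,…,n}`, extended by the identity. -/
def revIcc (n i : ℕ) : ℕ := if 1 ≤ i ∧ i ≤ n then n + 1 - i else i

theorem revIcc_revIcc (n i : ℕ) : revIcc n (revIcc n i) = i := by
  unfold revIcc; split_ifs <;> omega

theorem comap_revIcc_adj (n : ℕ) (G : SimpleGraph ℕ) (u v : ℕ) :
    (G.comap (revIcc n)).Adj u v ↔ G.Adj (revIcc n u) (revIcc n v) := Iff.rfl

theorem comap_revIcc_comap (n : ℕ) (G : SimpleGraph ℕ) :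
    (G.comap (revIcc n)).comap (revIcc n) = G := by
  ext u v
  simp [revIcc_revIcc]

theorem IsMatchingOn.comap_revIcc {n : ℕ} {G : SimpleGraph ℕ} (h : IsMatchingOn n G) :
    IsMatchingOn n (G.comap (revIcc n)) := by
  refine ⟨fun u v huv => ?_, fun v hv1 hv2 => ?_⟩
  · have := h.1 _ _ huv
    unfold revIcc at this
    split_ifs at this <;> omega
  · obtain ⟨u, hu, hu'⟩ := h.2 (revIcc n v) (by unfold revIcc; split_ifs <;> omega)
      (by unfold revIcc; split_ifs <;> omega)
    refine ⟨revIcc n u, by simpa [revIcc_revIcc] using hu, fun y hy => ?_⟩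
    rw [← hu' _ hy, revIcc_revIcc]

theorem HasBase.comap_revIcc {n : ℕ} {G : SimpleGraph ℕ} {w : ℕ → Bool} (h : IsMatchingOn n G)
    (hw : HasBase n G w) :
    HasBase n (G.comap (revIcc n)) (fun i => !w (n + 1 - i)) := by
  intro i hi1 hi2
  have hi : revIcc n i = n + 1 - i := by unfold revIcc; rw [if_pos ⟨hi1, hi2⟩]
  have key := hw (n + 1 - i) (by omega) (by omega)
  obtain ⟨u, hu, hu'⟩ := h.2 (n + 1 - i) (by omega) (by omega)
  have hb := h.1 _ _ hu
  rw [Bool.not_eq_true', ← Bool.not_eq_true, key]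
  constructor
  · intro hn
    refine ⟨revIcc n u, ?_, ?_⟩
    · have h1 : ¬ u < n + 1 - i := fun hlt => hn ⟨u, hlt, hu⟩
      have h2 : u ≠ n + 1 - i := fun he => G.loopless.irrefl _ (he ▸ hu)
      unfold revIcc; split_ifs <;> omega
    · rw [comap_revIcc_adj, revIcc_revIcc, hi]; exact hu
  · rintro ⟨j, hj, hadj⟩ ⟨k, hk, hadj'⟩
    rw [comap_revIcc_adj, hi] at hadj
    have := h.1 _ _ hadj
    rw [← hu' _ hadj] at hu
    rw [hu' _ hadj', ← hu' _ hadj] at hk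
    unfold revIcc at hk this
    split_ifs at hk this <;> omega

theorem containsPat_comap_revIcc {n : ℕ} {G : SimpleGraph ℕ} (h : IsMatchingOn n G) :
    ContainsPat (G.comap (revIcc n)) M132 ↔ ContainsPat G M213 := by
  rw [containsPat_M132_iff (fun u v huv => (h.comap_revIcc.1 u v huv).1),
    containsPat_M213_iff (fun u v huv => (h.1 u v huv).1)]
  have mono : ∀ {x y : ℕ}, 1 ≤ x → y ≤ n → x < y → revIcc n y < revIcc n x := by
    intro x y hx hy hxy
    unfold revIcc; split_ifs <;> omega
  constructor
  · rintro ⟨a, b, c, d, e, g, hab, hbc, hcd, hde, heg, h1, h2, h3⟩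
    have b1 := h.comap_revIcc.1 _ _ h1
    have b2 := h.comap_revIcc.1 _ _ h2
    have b3 := h.comap_revIcc.1 _ _ h3
    exact ⟨_, _, _, _, _, _, mono (by omega) (by omega) heg, mono (by omega) (by omega) hde,
      mono (by omega) (by omega) hcd, mono (by omega) (by omega) hbc,
      mono (by omega) (by omega) hab, h2.symm, h3.symm, h1.symm⟩
  · rintro ⟨a, b, c, d, e, g, hab, hbc, hcd, hde, heg, h1, h2, h3⟩
    have b1 := h.1 _ _ h1
    have b2 := h.1 _ _ h2
    have b3 := h.1 _ _ h3
    refine ⟨_, _, _, _, _, _, mono (by omega) (by omega) heg, mono (by omega) (by omega) hde,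
      mono (by omega) (by omega) hcd, mono (by omega) (by omega) hbc,
      mono (by omega) (by omega) hab, ?_, ?_, ?_⟩ <;>
      simp only [comap_revIcc_adj, revIcc_revIcc]
    exacts [h3.symm, h1.symm, h2.symm]

theorem hasBase_congr {n : ℕ} {G : SimpleGraph ℕ} {w w' : ℕ → Bool}
    (hww : ∀ i, 1 ≤ i → i ≤ n → w i = w' i) (h : HasBase n G w) : HasBase n G w' :=
  fun i h1 h2 => hww i h1 h2 ▸ h i h1 h2

/-- Reversing the vertex order turns avoidance of `M213` into avoidance of `M132`. -/
theorem card_avoid_M213_eq (n : ℕ) (w : ℕ → Bool) :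
    Nat.card {G : SimpleGraph ℕ // IsMatchingOn n G ∧ HasBase n G w ∧ ¬ ContainsPat G M213} =
    Nat.card {G : SimpleGraph ℕ // IsMatchingOn n G ∧ HasBase n G (fun i => !w (n + 1 - i)) ∧
      ¬ ContainsPat G M132} := by
  refine Nat.card_congr ⟨fun G => ⟨G.1.comap (revIcc n), G.2.1.comap_revIcc,
      G.2.2.1.comap_revIcc G.2.1, fun hc => G.2.2.2 ((containsPat_comap_revIcc G.2.1).1 hc)⟩,
    fun G => ⟨G.1.comap (revIcc n), G.2.1.comap_revIcc,
      hasBase_congr (fun i h1 h2 => ?_) (G.2.2.1.comap_revIcc G.2.1), fun hc => G.2.2.2 ?_⟩,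
    fun G => Subtype.ext (comap_revIcc_comap n G.1),
    fun G => Subtype.ext (comap_revIcc_comap n G.1)⟩
  · rw [Bool.not_not]; congr 1; omega
  · rw [← containsPat_comap_revIcc G.2.1.comap_revIcc, comap_revIcc_comap] at hc
    exact hc

theorem map_range'_reverse (n : ℕ) (w : ℕ → Bool) :
    (List.range' 1 n).map (fun i => !w (n + 1 - i)) =
      ((List.range' 1 n).map w).reverse.map not := by
  apply List.ext_getElem
  · simp
  · intro i h1 h2
    simp only [List.length_map, List.length_range'] at h1
    simp only [List.getElem_map, List.getElem_reverse, List.getElem_range', List.length_map,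
      List.length_range']
    congr 2
    omega

/-- The matchings on `[n]` with base `w` avoiding `M132` in which every r-vertex `r ≤ i` is
joined to `p r`. -/
def extensions (n : ℕ) (w : ℕ → Bool) (i : ℕ) (p : ℕ → ℕ) : Set (SimpleGraph ℕ) :=
  {G | (IsMatchingOn n G ∧ HasBase n G w ∧ ¬ ContainsPat G M132) ∧
    ∀ r, 1 ≤ r → r ≤ i → w r = true → G.Adj (p r) r}

/-- `L` lists, from newest to oldest, the open vertices of the partial matching on `[i]` that
joins each r-vertex `r` to `p r`; a vertex carries the flag `true` if closing it next creates no
occurrence of `M132`. -/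
structure OpenList (w : ℕ → Bool) (i : ℕ) (p : ℕ → ℕ) (L : List (ℕ × Bool)) : Prop where
  sorted : L.Pairwise fun x y => y.1 < x.1
  mem_iff : ∀ x, x ∈ L.map Prod.fst ↔ 1 ≤ x ∧ x ≤ i ∧ w x = false ∧
    ∀ r, 1 ≤ r → r ≤ i → w r = true → p r ≠ x
  left : ∀ r, 1 ≤ r → r ≤ i → w r = true → 1 ≤ p r ∧ p r < r ∧ w (p r) = false
  inj : ∀ r r', 1 ≤ r → r ≤ i → w r = true → 1 ≤ r' → r' ≤ i → w r' = true → p r = p r' → r = r'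
  avoid : ∀ r s t, 1 ≤ r → r < s → s < t → t ≤ i → w r = true → w s = true → w t = true →
    p r < p t → p t < p s → ¬ p s < r
  avoid_open : ∀ r s y, 1 ≤ r → r < s → s ≤ i → w r = true → w s = true → y ∈ L.map Prod.fst →
    p r < y → y < p s → ¬ p s < r
  flag : ∀ x b, (x, b) ∈ L → (b = true ↔ ∀ y r, y ∈ L.map Prod.fst → y < x → 1 ≤ r → r ≤ i →
    w r = true → x < r → ¬ p r < y)

theorem OpenList.nil (w : ℕ → Bool) (p : ℕ → ℕ) : OpenList w 0 p [] := by
  constructor <;> intros <;> first | omega | simp_all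
  omega

theorem OpenList.open_succ {w : ℕ → Bool} {i : ℕ} {p : ℕ → ℕ} {L : List (ℕ × Bool)}
    (h : OpenList w i p L) (hw : w (i + 1) = false) : OpenList w (i + 1) p ((i + 1, true) :: L) := by
  have le : ∀ r, r ≤ i + 1 → w r = true → r ≤ i := by
    intro r hr hwr
    rcases Nat.lt_or_ge i r with h1 | h1
    · have : r = i + 1 := by omega
      subst this; simp_all
    · exact h1
  have memL : ∀ x, x ∈ L.map Prod.fst → x ≤ i := fun x hx => ((h.mem_iff x).1 hx).2.1
  have memcons : ∀ x, x ∈ ((i + 1, true) :: L).map Prod.fst ↔ x = i + 1 ∨ x ∈ L.map Prod.fst :=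
    fun x => by simp only [List.map_cons, List.mem_cons]
  refine ⟨?_, ?_, fun r h1 h2 h3 => h.left r h1 (le r h2 h3) h3,
    fun r s h1 h2 h3 h4 h5 h6 => h.inj r s h1 (le r h2 h3) h3 h4 (le s h5 h6) h6,
    fun r s t h1 h2 h3 h4 h5 h6 h7 => h.avoid r s t h1 h2 h3 (le t h4 h7) h5 h6 h7, ?_, ?_⟩
  · refine List.pairwise_cons.2 ⟨fun y hy => ?_, h.sorted⟩
    have := memL y.1 (List.mem_map_of_mem hy)
    show y.1 < i + 1
    omega
  · intro x
    rw [memcons, h.mem_iff]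
    constructor
    · rintro (rfl | ⟨h1, h2, h3, h4⟩)
      · refine ⟨by omega, le_rfl, hw, fun r h1 h2 h3 h4 => ?_⟩
        have := h.left r h1 (le r h2 h3) h3
        have := le r h2 h3
        omega
      · exact ⟨h1, by omega, h3, fun r h5 h6 h7 => h4 r h5 (le r h6 h7) h7⟩
    · rintro ⟨h1, h2, h3, h4⟩
      rcases Nat.lt_or_ge i x with h5 | h5
      · left; omega
      · exact Or.inr ⟨h1, h5, h3, fun r h6 h7 => h4 r h6 (by omega)⟩
  · intro r s y h1 h2 h3 h4 h5 h6 h7 h8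
    rcases (memcons y).1 h6 with rfl | hy
    · have := h.left s (by omega) (le s h3 h5) h5
      omega
    · exact h.avoid_open r s y h1 h2 (le s h3 h5) h4 h5 hy h7 h8
  · intro x b hx
    rcases List.mem_cons.1 hx with hx | hx
    · obtain ⟨rfl, rfl⟩ := Prod.mk.inj hx
      simp only [true_iff]
      intros
      omega
    · rw [h.flag x b hx]
      have hxi := memL x (List.mem_map_of_mem hx)
      constructor
      · intro H y r h1 h2 h3 h4 h5
        rcases (memcons y).1 h1 with rfl | hy
        · omega
        · exact H y r hy h2 h3 (le r h4 h5) h5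
      · intro H y r h1 h2 h3 h4 h5
        exact H y r ((memcons y).2 (Or.inr h1)) h2 h3 (by omega) h5

theorem OpenList.close {w : ℕ → Bool} {i : ℕ} {p : ℕ → ℕ} {pre post L' : List (ℕ × Bool)} {x : ℕ}
    (h : OpenList w i p (pre ++ (x, true) :: post)) (hw : w (i + 1) = true)
    (hL : L'.map Prod.fst = pre.map Prod.fst ++ post.map Prod.fst)
    (hflag : ∀ z b, (z, b) ∈ L' → (z < x ∧ (z, b) ∈ post) ∨
      (x < z ∧ (b = true ↔ ∀ y ∈ pre.map Prod.fst, z ≤ y))) :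
    OpenList w (i + 1) (Function.update p (i + 1) x) L' := by
  set L := pre ++ (x, true) :: post with hLdef
  have hxL : (x, true) ∈ L := by simp [hLdef]
  have hx := (h.mem_iff x).1 (List.mem_map_of_mem hxL)
  have hfree := (h.flag x true hxL).1 rfl
  have upd : ∀ r, r ≤ i → Function.update p (i + 1) x r = p r := fun r hr =>
    Function.update_of_ne (by omega) _ _
  have upd' : Function.update p (i + 1) x (i + 1) = x := Function.update_self _ _ _
  have hs := h.sorted
  rw [hLdef, List.pairwise_append] at hs
  obtain ⟨hs1, hs2, hs3⟩ := hs
  have hs2' := List.pairwise_cons.1 hs2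
  have hpre : ∀ y ∈ pre.map Prod.fst, x < y := by
    intro y hy
    obtain ⟨z, hz, rfl⟩ := List.mem_map.1 hy
    exact hs3 z hz (x, true) (by simp)
  have hpost : ∀ y ∈ post.map Prod.fst, y < x := by
    intro y hy
    obtain ⟨z, hz, rfl⟩ := List.mem_map.1 hy
    exact hs2'.1 z hz
  have memL : ∀ y, y ∈ L.map Prod.fst ↔ y ∈ pre.map Prod.fst ∨ y = x ∨ y ∈ post.map Prod.fst := by
    intro y
    rw [hLdef, List.map_append, List.mem_append, List.map_cons, List.mem_cons]
  have memL' : ∀ y, y ∈ L'.map Prod.fst ↔ y ∈ L.map Prod.fst ∧ y ≠ x := by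
    intro y
    rw [hL, List.mem_append, memL]
    constructor
    · rintro (hy | hy)
      · exact ⟨Or.inl hy, (hpre y hy).ne'⟩
      · exact ⟨Or.inr (Or.inr hy), (hpost y hy).ne⟩
    · tauto
  have cases_le : ∀ r, r ≤ i + 1 → r ≤ i ∨ r = i + 1 := fun r hr => by omega
  constructor
  · have hm : (L'.map Prod.fst).Pairwise (fun a b => b < a) := by
      rw [hL, List.pairwise_append]
      refine ⟨List.pairwise_map.2 hs1, List.pairwise_map.2 hs2'.2, fun a ha b hb => ?_⟩
      exact (hpost b hb).trans (hpre a ha)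
    exact List.pairwise_map.1 hm
  · intro y
    rw [memL', h.mem_iff]
    constructor
    · rintro ⟨⟨h1, h2, h3, h4⟩, h5⟩
      refine ⟨h1, by omega, h3, fun r h6 h7 h8 => ?_⟩
      rcases cases_le r h7 with h9 | rfl
      · rw [upd r h9]; exact h4 r h6 h9 h8
      · rw [upd']; exact h5.symm
    · rintro ⟨h1, h2, h3, h4⟩
      refine ⟨⟨h1, ?_, h3, fun r h6 h7 h8 => ?_⟩, ?_⟩
      · rcases cases_le y h2 with h9 | rfl
        · exact h9
        · simp_all
      · rw [← upd r h7]; exact h4 r h6 (by omega) h8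
      · have := h4 (i + 1) (by omega) le_rfl hw
        rw [upd'] at this; exact this.symm
  · intro r h1 h2 h3
    rcases cases_le r h2 with h4 | rfl
    · rw [upd r h4]; exact h.left r h1 h4 h3
    · rw [upd']; exact ⟨hx.1, by omega, hx.2.2.1⟩
  · intro r s h1 h2 h3 h4 h5 h6 he
    rcases cases_le r h2 with h7 | rfl <;> rcases cases_le s h5 with h8 | rfl
    · rw [upd r h7, upd s h8] at he; exact h.inj r s h1 h7 h3 h4 h8 h6 he
    · rw [upd r h7, upd'] at he; exact absurd he (hx.2.2.2 r h1 h7 h3)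
    · rw [upd s h8, upd'] at he; exact absurd he.symm (hx.2.2.2 s h4 h8 h6)
    · rfl
  · intro r s t h1 h2 h3 h4 h5 h6 h7
    rw [upd r (by omega), upd s (by omega)]
    rcases cases_le t h4 with h8 | rfl
    · rw [upd t h8]; exact h.avoid r s t h1 h2 h3 h8 h5 h6 h7
    · rw [upd']
      exact h.avoid_open r s x h1 h2 (by omega) h5 h6 (List.mem_map_of_mem hxL)
  · intro r s y h1 h2 h3 h4 h5 h6
    have h6' := (memL' y).1 h6
    rw [upd r (by omega)]
    rcases cases_le s h3 with h8 | rfl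
    · rw [upd s h8]; exact h.avoid_open r s y h1 h2 h8 h4 h5 h6'.1
    · rw [upd']
      intro h9 h10 h11
      exact hfree y r h6'.1 h10 h1 (by omega) h4 h11 h9
  · intro z b hz
    have hzL := (memL' z).1 (List.mem_map_of_mem hz)
    have hzi := ((h.mem_iff z).1 hzL.1).2.1
    rcases hflag z b hz with ⟨hzx, hzp⟩ | ⟨hzx, hb⟩
    · rw [h.flag z b (by simp [hLdef, hzp])]
      constructor
      · intro H y r h1 h2 h3 h4 h5 h6
        rcases cases_le r h4 with h7 | rfl
        · rw [upd r h7]; exact H y r ((memL' y).1 h1).1 h2 h3 h7 h5 h6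
        · rw [upd']; omega
      · intro H y r h1 h2 h3 h4 h5 h6
        rw [← upd r h4]
        exact H y r ((memL' y).2 ⟨h1, by omega⟩) h2 h3 (by omega) h5 h6
    · rw [hb]
      constructor
      · intro H y r h1 h2 h3 h4 h5 h6
        have hyx : y < x := by
          have h7 := (memL' y).1 h1
          rcases (memL y).1 h7.1 with h8 | h8 | h8
          · have := H y h8; omega
          · exact absurd h8 h7.2
          · exact hpost y h8
        rcases cases_le r h4 with h7 | rfl
        · rw [upd r h7]
          exact hfree y r ((memL' y).1 h1).1 hyx h3 h7 h5 (by omega)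
        · rw [upd']; omega
      · intro H y hy
        by_contra hlt
        refine H y (i + 1) ((memL' y).2 ⟨(memL y).2 (Or.inl hy), (hpre y hy).ne'⟩) (by omega)
          (by omega) le_rfl hw (by omega) ?_
        rw [upd']; exact hpre y hy

theorem OpenList.exists_close {w : ℕ → Bool} {i : ℕ} {p : ℕ → ℕ} {pre post : List (ℕ × Bool)}
    {x : ℕ} (h : OpenList w i p (pre ++ (x, true) :: post)) (hw : w (i + 1) = true) :
    ∃ L', OpenList w (i + 1) (Function.update p (i + 1) x) L' ∧
      L'.map Prod.snd = fillState pre.length (post.map Prod.snd) := by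
  have hs := h.sorted
  rw [List.pairwise_append, List.pairwise_cons] at hs
  obtain ⟨hs1, ⟨hs2, -⟩, hs3⟩ := hs
  rcases List.eq_nil_or_concat pre with rfl | ⟨pre', y, hpre⟩
  · exact ⟨post, h.close hw (by simp) fun z b hz => Or.inl ⟨hs2 _ hz, hz⟩, by simp [fillState]⟩
  · rw [List.concat_eq_append] at hpre
    subst hpre
    rw [List.pairwise_append] at hs1
    refine ⟨pre'.map (fun z => (z.1, false)) ++ (y.1, true) :: post, h.close hw ?_ ?_, ?_⟩
    · simp [Function.comp_def]
    · intro z b hz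
      rcases List.mem_append.1 hz with hz | hz
      · obtain ⟨a, ha, hab⟩ := List.mem_map.1 hz
        obtain ⟨rfl, rfl⟩ := Prod.mk.inj hab
        refine Or.inr ⟨hs3 a (by simp [ha]) (x, true) (by simp), ?_⟩
        simp only [Bool.false_eq_true, false_iff]
        intro H
        have h1 := H y.1 (by simp)
        have h2 := hs1.2.2 a ha y (by simp)
        omega
      · rcases List.mem_cons.1 hz with hz | hz
        · obtain ⟨rfl, rfl⟩ := Prod.mk.inj hz
          refine Or.inr ⟨hs3 y (by simp) (x, true) (by simp), ?_⟩
          simp only [true_iff]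
          intro a ha
          obtain ⟨c, hc, rfl⟩ := List.mem_map.1 ha
          rcases List.mem_append.1 hc with hc | hc
          · exact (hs1.2.2 c hc y (by simp)).le
          · rw [List.mem_singleton.1 hc]
        · exact Or.inl ⟨hs2 _ hz, hz⟩
    · simp [fillState, Function.comp_def, List.map_const']

theorem IsMatchingOn.eq_of_adj {n : ℕ} {G : SimpleGraph ℕ} (h : IsMatchingOn n G) {u v v' : ℕ}
    (h1 : G.Adj u v) (h2 : G.Adj u v') : v = v' :=
  (h.2 u (h.1 _ _ h1).1 (h.1 _ _ h1).2.1).unique h1 h2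

theorem HasBase.eq_true {n : ℕ} {G : SimpleGraph ℕ} {w : ℕ → Bool} (hb : HasBase n G w)
    (h : IsMatchingOn n G) {u v : ℕ} (huv : G.Adj u v) (hlt : u < v) : w v = true :=
  (hb v (h.1 _ _ huv).2.2.1 (h.1 _ _ huv).2.2.2).2 ⟨u, hlt, huv.symm⟩

theorem HasBase.eq_false {n : ℕ} {G : SimpleGraph ℕ} {w : ℕ → Bool} (hb : HasBase n G w)
    (h : IsMatchingOn n G) {u v : ℕ} (huv : G.Adj u v) (hlt : u < v) : w u = false := by
  rw [← Bool.not_eq_true, hb u (h.1 _ _ huv).1 (h.1 _ _ huv).2.1]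
  rintro ⟨j, hj, hadj⟩
  have := h.eq_of_adj huv hadj
  omega

theorem exists_adj_of_mem_open {n i : ℕ} {w : ℕ → Bool} {p : ℕ → ℕ} {L : List (ℕ × Bool)}
    (h : OpenList w i p L) (hi : i ≤ n) {G : SimpleGraph ℕ} (hG : G ∈ extensions n w i p) {y : ℕ}
    (hy : y ∈ L.map Prod.fst) : ∃ u, G.Adj y u ∧ i < u ∧ u ≤ n := by
  obtain ⟨⟨hm, hb, -⟩, hp⟩ := hG
  obtain ⟨h1, h2, h3, h4⟩ := (h.mem_iff y).1 hy
  obtain ⟨u, hu, -⟩ := hm.2 y h1 (by omega)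
  have hbd := hm.1 _ _ hu
  refine ⟨u, hu, ?_, hbd.2.2.2⟩
  by_contra hui
  have hne : u ≠ y := fun he => G.loopless.irrefl _ (he ▸ hu)
  rcases Nat.lt_or_ge u y with hlt | hge
  · have := hb.eq_true hm hu.symm hlt
    simp_all
  · have hwu := hb.eq_true hm hu (by omega)
    have hadj := hp u hbd.2.2.1 (by omega) hwu
    exact h4 u hbd.2.2.1 (by omega) hwu (hm.eq_of_adj hadj.symm hu.symm)

theorem extensions_update {n i : ℕ} {w : ℕ → Bool} {p : ℕ → ℕ} (hw : w (i + 1) = true) (x : ℕ) :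
    extensions n w (i + 1) (Function.update p (i + 1) x) =
      {G ∈ extensions n w i p | G.Adj x (i + 1)} := by
  ext G
  simp only [extensions, Set.mem_ofPred_eq]
  constructor
  · rintro ⟨hG, hp⟩
    refine ⟨⟨hG, fun r h1 h2 h3 => ?_⟩, ?_⟩
    · have := hp r h1 (by omega) h3
      rwa [Function.update_of_ne (by omega)] at this
    · have := hp (i + 1) (by omega) le_rfl hw
      rwa [Function.update_self] at this
  · rintro ⟨⟨hG, hp⟩, hx⟩
    refine ⟨hG, fun r h1 h2 h3 => ?_⟩
    rcases eq_or_ne r (i + 1) with rfl | hne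
    · rwa [Function.update_self]
    · rw [Function.update_of_ne hne]; exact hp r h1 (by omega) h3

theorem extensions_blocked {n i : ℕ} {w : ℕ → Bool} {p : ℕ → ℕ} {L : List (ℕ × Bool)}
    (h : OpenList w i p L) (hi : i ≤ n) {x : ℕ} (hx : (x, false) ∈ L) :
    {G ∈ extensions n w i p | G.Adj x (i + 1)} = ∅ := by
  rw [Set.eq_empty_iff_forall_notMem]
  rintro G ⟨hG, hadj⟩
  have hfl := (not_congr (h.flag x false hx)).1 (by simp)
  push Not at hfl
  obtain ⟨y, r, h1, h2, h3, h4, h5, h6, h7⟩ := hfl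
  obtain ⟨u, hu, hui, -⟩ := exists_adj_of_mem_open h hi hG h1
  have hne : u ≠ i + 1 := by
    rintro rfl
    have := hG.1.1.eq_of_adj hu.symm hadj.symm
    omega
  exact hG.1.2.2 ((containsPat_M132_iff fun a b hab => (hG.1.1.1 a b hab).1).2
    ⟨p r, y, x, r, i + 1, u, h7, h2, h6, by omega, by omega, hG.2 r h3 h4 h5, hu, hadj⟩)

theorem extensions_open_succ {n i : ℕ} {w : ℕ → Bool} (p : ℕ → ℕ) (hw : w (i + 1) = false) :
    extensions n w (i + 1) p = extensions n w i p := by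
  ext G
  refine and_congr_right fun _ => ⟨fun H r h1 h2 h3 => H r h1 (by omega) h3,
    fun H r h1 h2 h3 => ?_⟩
  rcases eq_or_ne r (i + 1) with rfl | hne
  · simp_all
  · exact H r h1 (by omega) h3

theorem exists_mem_open_adj {n i : ℕ} {w : ℕ → Bool} {p : ℕ → ℕ} {L : List (ℕ × Bool)}
    (h : OpenList w i p L) (hi : i + 1 ≤ n) (hw : w (i + 1) = true) {G : SimpleGraph ℕ}
    (hG : G ∈ extensions n w i p) : ∃ x ∈ L.map Prod.fst, G.Adj x (i + 1) := by
  obtain ⟨⟨hm, hb, -⟩, hp⟩ := hG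
  obtain ⟨j, hj, hadj⟩ := (hb (i + 1) (by omega) hi).1 hw
  refine ⟨j, (h.mem_iff j).2 ⟨(hm.1 _ _ hadj).2.2.1, by omega, hb.eq_false hm hadj.symm hj,
    fun r h1 h2 h3 he => ?_⟩, hadj.symm⟩
  have := hm.eq_of_adj (he ▸ hp r h1 h2 h3) hadj.symm
  omega

/-- The matching joining each r-vertex `v ≤ n` to `p v`. -/
def matchingOf (n : ℕ) (w : ℕ → Bool) (p : ℕ → ℕ) : SimpleGraph ℕ :=
  SimpleGraph.fromRel fun u v => 1 ≤ v ∧ v ≤ n ∧ w v = true ∧ u = p v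

theorem OpenList.matchingOf_adj_iff {n : ℕ} {w : ℕ → Bool} {p : ℕ → ℕ} {L : List (ℕ × Bool)}
    (h : OpenList w n p L) {u v : ℕ} (huv : u < v) :
    (matchingOf n w p).Adj u v ↔ 1 ≤ v ∧ v ≤ n ∧ w v = true ∧ u = p v := by
  rw [matchingOf, SimpleGraph.fromRel_adj]
  constructor
  · rintro ⟨-, H | ⟨h1, h2, h3, h4⟩⟩
    · exact H
    · have := h.left u h1 h2 h3
      omega
  · intro H
    exact ⟨huv.ne, Or.inl H⟩

theorem OpenList.matchingOf_mem {n : ℕ} {w : ℕ → Bool} {p : ℕ → ℕ} (h : OpenList w n p []) :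
    matchingOf n w p ∈ extensions n w n p := by
  have hadj : ∀ r, 1 ≤ r → r ≤ n → w r = true → (matchingOf n w p).Adj (p r) r :=
    fun r h1 h2 h3 => (h.matchingOf_adj_iff (h.left r h1 h2 h3).2.1).2 ⟨h1, h2, h3, rfl⟩
  have hcases : ∀ u v, (matchingOf n w p).Adj u v →
      (1 ≤ v ∧ v ≤ n ∧ w v = true ∧ u = p v) ∨ (1 ≤ u ∧ u ≤ n ∧ w u = true ∧ v = p u) := by
    intro u v huv
    exact ((SimpleGraph.fromRel_adj _ _ _).1 huv).2
  have hrange : ∀ u v, (matchingOf n w p).Adj u v → 1 ≤ u ∧ u ≤ n ∧ 1 ≤ v ∧ v ≤ n := by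
    intro u v huv
    rcases hcases u v huv with ⟨h1, h2, h3, h4⟩ | ⟨h1, h2, h3, h4⟩
    · have := h.left v h1 h2 h3
      omega
    · have := h.left u h1 h2 h3
      omega
  refine ⟨⟨⟨hrange, fun v hv1 hv2 => ?_⟩, fun v hv1 hv2 => ?_, fun hc => ?_⟩, hadj⟩
  · cases hwv : w v
    · have hex : ∃ r, 1 ≤ r ∧ r ≤ n ∧ w r = true ∧ p r = v := by
        by_contra hno
        push Not at hno
        exact List.not_mem_nil ((h.mem_iff v).2 ⟨hv1, hv2, hwv, hno⟩)
      obtain ⟨r, h1, h2, h3, rfl⟩ := hex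
      refine ⟨r, hadj r h1 h2 h3, fun u hu => ?_⟩
      rcases hcases _ _ hu with ⟨h4, h5, h6, h7⟩ | ⟨h4, h5, h6, h7⟩
      · exact (h.inj r u h1 h2 h3 h4 h5 h6 h7).symm
      · simp_all
    · refine ⟨p v, (hadj v hv1 hv2 hwv).symm, fun u hu => ?_⟩
      rcases hcases _ _ hu with ⟨h4, h5, h6, h7⟩ | ⟨h4, h5, h6, h7⟩
      · have := (h.left u h4 h5 h6).2.2
        simp_all
      · exact h7
  · constructor
    · exact fun hwv => ⟨p v, (h.left v hv1 hv2 hwv).2.1, (hadj v hv1 hv2 hwv).symm⟩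
    · rintro ⟨j, hj, hvj⟩
      exact ((h.matchingOf_adj_iff hj).1 hvj.symm).2.2.1
  · obtain ⟨a, b, c, d, e, g, hab, hbc, hcd, hde, heg, h1, h2, h3⟩ :=
      (containsPat_M132_iff fun u v huv => (hrange u v huv).1).1 hc
    obtain ⟨d1, d2, d3, rfl⟩ := (h.matchingOf_adj_iff (by omega)).1 h1
    obtain ⟨g1, g2, g3, rfl⟩ := (h.matchingOf_adj_iff (by omega)).1 h2
    obtain ⟨e1, e2, e3, rfl⟩ := (h.matchingOf_adj_iff (by omega)).1 h3
    exact h.avoid d e g d1 hde heg g2 d3 e3 g3 hab hbc hcd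

theorem OpenList.extensions_eq_singleton {n : ℕ} {w : ℕ → Bool} {p : ℕ → ℕ}
    (h : OpenList w n p []) : extensions n w n p = {matchingOf n w p} := by
  refine Set.eq_singleton_iff_unique_mem.2 ⟨h.matchingOf_mem, fun G hG => ?_⟩
  obtain ⟨⟨hm, hb, -⟩, hp⟩ := hG
  have key : ∀ u v, u < v → (G.Adj u v ↔ (matchingOf n w p).Adj u v) := by
    intro u v huv
    rw [h.matchingOf_adj_iff huv]
    constructor
    · intro hadj
      have hbd := hm.1 _ _ hadj
      have hwv := hb.eq_true hm hadj huv
      exact ⟨hbd.2.2.1, hbd.2.2.2, hwv,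
        hm.eq_of_adj hadj.symm (hp v hbd.2.2.1 hbd.2.2.2 hwv).symm⟩
    · rintro ⟨h1, h2, h3, rfl⟩
      exact hp v h1 h2 h3
  ext u v
  rcases lt_trichotomy u v with huv | rfl | huv
  · exact key u v huv
  · simp
  · rw [G.adj_comm, (matchingOf n w p).adj_comm]
    exact key v u huv

theorem OpenList.encard_extensions {n : ℕ} {w : ℕ → Bool} (k i : ℕ) (hi : i + k = n) (p : ℕ → ℕ)
    (L : List (ℕ × Bool)) (h : OpenList w i p L) :
    (extensions n w i p).encard =
      runSum (fun s => statePairing s []) ((List.range' (i + 1) k).map w) (L.map Prod.snd) := by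
  induction k generalizing i p L with
  | zero =>
    obtain rfl : i = n := hi
    rcases L with _ | ⟨⟨x, b⟩, L⟩
    · rw [h.extensions_eq_singleton, Set.encard_singleton]
      simp [runSum, statePairing]
    · have hemp : extensions i w i p = ∅ := by
        rw [Set.eq_empty_iff_forall_notMem]
        intro G hG
        obtain ⟨u, -, h1, h2⟩ := exists_adj_of_mem_open h le_rfl hG (y := x) (by simp)
        omega
      simp [hemp, runSum, statePairing, slackCount_succ_nil_right]
  | succ k ih =>
    rw [List.range'_succ, List.map_cons]
    cases hw : w (i + 1)
    · rw [← extensions_open_succ p hw, ih (i + 1) (by omega) p _ (h.open_succ hw)]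
      rfl
    · have key : ∀ rest pre : List (ℕ × Bool), L = pre ++ rest →
          {G ∈ extensions n w i p | ∃ x ∈ rest.map Prod.fst, G.Adj x (i + 1)}.encard =
            closeSum (runSum (fun s => statePairing s []) ((List.range' (i + 1 + 1) k).map w))
              pre.length (rest.map Prod.snd) := by
        intro rest
        induction rest with
        | nil => intro pre _; simp [closeSum]
        | cons xb rest ihr =>
          obtain ⟨x, b⟩ := xb
          intro pre hL
          have hsplit : {G ∈ extensions n w i p |
                ∃ z ∈ ((x, b) :: rest).map Prod.fst, G.Adj z (i + 1)} =
              {G ∈ extensions n w i p | G.Adj x (i + 1)} ∪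
              {G ∈ extensions n w i p | ∃ z ∈ rest.map Prod.fst, G.Adj z (i + 1)} := by
            ext G
            simp only [List.map_cons, List.mem_cons, Set.mem_ofPred_eq, Set.mem_union,
              exists_eq_or_imp]
            tauto
          have hdisj : Disjoint {G ∈ extensions n w i p | G.Adj x (i + 1)}
              {G ∈ extensions n w i p | ∃ z ∈ rest.map Prod.fst, G.Adj z (i + 1)} := by
            rw [Set.disjoint_left]
            rintro G ⟨hG, hx⟩ ⟨-, z, hz, hz'⟩
            have he := hG.1.1.eq_of_adj hx.symm hz'.symm
            have hs := h.sorted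
            rw [hL, List.pairwise_append, List.pairwise_cons] at hs
            obtain ⟨a, ha, rfl⟩ := List.mem_map.1 hz
            have := hs.2.1.1 a ha
            simp only at this
            omega
          have hrest := ihr (pre ++ [(x, b)]) (by simp [hL])
          rw [List.length_append, List.length_singleton] at hrest
          rw [hsplit, Set.encard_union_eq hdisj, hrest, List.map_cons, closeSum, Nat.cast_add]
          congr 1
          cases b
          · rw [extensions_blocked h (by omega) (by simp [hL])]
            simp
          · subst hL
            obtain ⟨L', hL', hsnd⟩ := h.exists_close hw
            rw [← extensions_update hw, ih (i + 1) (by omega) _ L' hL', hsnd]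
            simp
      have hall : {G ∈ extensions n w i p | ∃ x ∈ L.map Prod.fst, G.Adj x (i + 1)} =
          extensions n w i p :=
        Set.sep_eq_self_iff_mem_true.2 fun G hG => exists_mem_open_adj h (by omega) hw hG
      rw [← hall, key L [] rfl]
      rfl

/-- The number of `M132`-avoiding matchings with base `w` is computed by reading `w`. -/
theorem card_avoid_M132_eq (n : ℕ) (w : ℕ → Bool) :
    Nat.card {G : SimpleGraph ℕ // IsMatchingOn n G ∧ HasBase n G w ∧ ¬ ContainsPat G M132} =
      runSum (fun s => statePairing s []) ((List.range' 1 n).map w) [] := by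
  have h := (OpenList.nil w id).encard_extensions n 0 (Nat.zero_add n)
  have hset : extensions n w 0 id =
      {G | IsMatchingOn n G ∧ HasBase n G w ∧ ¬ ContainsPat G M132} := by
    ext G
    refine and_iff_left fun r h1 h2 => ?_
    omega
  rw [hset] at h
  change Nat.card ↥{G | IsMatchingOn n G ∧ HasBase n G w ∧ ¬ ContainsPat G M132} = _
  rw [Nat.card_coe_set_eq, Set.ncard, h]
  simp

/-- `g(m,w,M_132) = g(m,w,M_213)` for every positive `m` and
Dyck word `w` of length `2m`. -/
theorem stmt1 (m : ℕ) (hm : 0 < m) (w : ℕ → Bool) (hw : IsDyckWord (2*m) w) :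
    Nat.card {G : SimpleGraph ℕ // IsMatchingOn (2*m) G ∧ HasBase (2*m) G w ∧
      ¬ ContainsPat G M132} =
    Nat.card {G : SimpleGraph ℕ // IsMatchingOn (2*m) G ∧ HasBase (2*m) G w ∧
      ¬ ContainsPat G M213} := by
  rw [card_avoid_M213_eq, card_avoid_M132_eq, card_avoid_M132_eq, map_range'_reverse,
    runSum_reverse]
end

section
/- For every m ≥ 4 there exists a Dyck word w of length 2m such that g(m,w,M_132) < g(m,w,M_123); consequently, for every m ≥ 4, the total number of matchings of size m avoiding M_132 is strictly smaller than the total number of matchings of size m avoiding M_123. -/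
/-- The link pattern of `p` stubs with links `L` after stub `i` is matched by an edge covering
all later stubs. -/
def updLink (p : ℕ) (L : ℕ → Bool) (i q : ℕ) : Bool :=
  if q < i then L q else decide (i < q ∧ q + 1 < p)

/-- The number of ways to complete, along the letters `k + 1, …, k + d` of `w`, a state of `p` stubs
with links `L`, when stub `i` may be matched only if `L (i + δ)` is false. -/
def countCompletions (δ : ℕ) (w : ℕ → Bool) : ℕ → ℕ → ℕ → (ℕ → Bool) → ℕ
  | 0, _, p, _ => if p = 0 then 1 else 0
  | d + 1, k, p, L =>
    if w (k + 1) then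
      ∑ i ∈ Finset.range p,
        if L (i + δ) then 0 else countCompletions δ w d (k + 1) (p - 1) (updLink p L i)
    else countCompletions δ w d (k + 1) (p + 1) L

/-- The word `(01) ^ n 00010111`, with letters indexed from `1`. -/
def strictWord (n j : ℕ) : Bool := decide ((j % 2 = 0 ∧ j ≠ 2 * n + 2) ∨ j = 2 * n + 7)


theorem countCompletions_zero_le_one (w : ℕ → Bool) (d : ℕ) :
    ∀ (k p : ℕ) (L L' : ℕ → Bool), L 0 = false → (∀ q, p ≤ q → L q = false) →
      (∀ q, L' q = true → L q = true) →
      countCompletions 0 w d k p L ≤ countCompletions 1 w d k p L' := by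
  induction d with
  | zero => intro k p L L' _ _ _; simp [countCompletions]
  | succ d ih =>
    intro k p L L' h0 hp hle
    simp only [countCompletions]
    split_ifs with hw
    · have hex : ∀ i, ∃ e, i ≤ e ∧ L (e + 1) = false := fun i =>
        ⟨i + p, by omega, hp _ (by omega)⟩
      choose e hie hLe hmin using fun i =>
        (⟨Nat.find (hex i), (Nat.find_spec (hex i)).1, (Nat.find_spec (hex i)).2,
          fun j hij hL => Nat.find_min' (hex i) ⟨hij, hL⟩⟩ :
          ∃ e, i ≤ e ∧ L (e + 1) = false ∧ ∀ j, i ≤ j → L (j + 1) = false → e ≤ j)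
      have hlt : ∀ i, i < p → e i < p := fun i hi => by
        have := hmin i (p - 1) (by omega) (hp _ (by omega)); omega
      have hinj : ∀ i j, L i = false → L j = false → i < j → e i < e j := fun i j _ hj hij => by
        obtain ⟨j, rfl⟩ : ∃ j', j = j' + 1 := ⟨j - 1, by omega⟩
        have := hmin i j (by omega) hj
        have := hie (j + 1)
        omega
      rw [← Finset.sum_filter_add_sum_filter_not (Finset.range p) (fun i => L i = false)]
      have hz : ∑ i ∈ Finset.range p with ¬ L i = false,
          (if L (i + 0) then 0 else
            countCompletions 0 w d (k + 1) (p - 1) (updLink p L i)) = 0 := by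
        apply Finset.sum_eq_zero
        intro i hi
        simp only [Finset.mem_filter, Bool.not_eq_false] at hi
        simp [hi.2]
      rw [hz, add_zero]
      calc _ ≤ ∑ i ∈ Finset.range p with L i = false, (if L' (e i + 1) then 0 else
            countCompletions 1 w d (k + 1) (p - 1) (updLink p L' (e i))) := by
              apply Finset.sum_le_sum
              intro i hi
              simp only [Finset.mem_filter, Finset.mem_range] at hi
              have h1 : L' (e i + 1) = false := by
                by_contra h
                have := hle _ (by simpa using h)
                simp [hLe] at this
              simp only [add_zero, hi.2, h1, Bool.false_eq_true, if_false]
              apply ih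
              · simp only [updLink]; split_ifs <;> simp [h0]
              · intro q hq
                simp only [updLink]
                split_ifs with h
                · omega
                · simp; omega
              · intro q hq
                have hei := hie i
                simp only [updLink] at hq ⊢
                split_ifs at hq with h
                · have hq' := hle _ hq
                  split_ifs with h'
                  · exact hq'
                  · have hqp : q ≠ i := by rintro rfl; simp [hi.2] at hq'
                    have := hlt i hi.1
                    simp; omega
                · simp at hq
                  rw [if_neg (by omega)]
                  simp; omega
        _ = ∑ j ∈ (Finset.range p |>.filter fun i => L i = false).image e,
            (if L' (j + 1) then 0 else
            countCompletions 1 w d (k + 1) (p - 1) (updLink p L' j)) := by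
              rw [Finset.sum_image]
              intro i hi j hj hij
              simp only [Finset.coe_filter, Set.mem_ofPred_eq] at hi hj
              rcases lt_trichotomy i j with h | h | h
              · have := hinj i j hi.2 hj.2 h; omega
              · exact h
              · have := hinj j i hj.2 hi.2 h; omega
        _ ≤ _ := by
              apply Finset.sum_le_sum_of_subset
              intro j hj
              simp only [Finset.mem_image, Finset.mem_filter, Finset.mem_range] at hj ⊢
              obtain ⟨i, hi, rfl⟩ := hj
              exact hlt i hi.1
    · apply ih _ _ _ _ h0 (fun q hq => hp q (by omega)) hle

theorem countCompletions_congr (δ : ℕ) (w w' : ℕ → Bool) (d : ℕ) :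
    ∀ (k k' p : ℕ) (L : ℕ → Bool), (∀ j, 1 ≤ j → j ≤ d → w (k + j) = w' (k' + j)) →
      countCompletions δ w d k p L = countCompletions δ w' d k' p L := by
  induction d with
  | zero => intro k k' p L _; rfl
  | succ d ih =>
    intro k k' p L h
    have ih' := fun p L => ih (k + 1) (k' + 1) p L fun j hj hjd => by
      have := h (j + 1) (by omega) (by omega)
      rwa [show k + 1 + j = k + (j + 1) by omega, show k' + 1 + j = k' + (j + 1) by omega]
    simp only [countCompletions, ih', h 1 le_rfl (by omega)]

theorem countCompletions_strictWord (δ n r : ℕ) : ∀ k, k + 2 * r = 2 * n →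
    countCompletions δ (strictWord n) (2 * r + 8) k 0 (fun _ => false) =
      countCompletions δ (strictWord 0) 8 0 0 fun _ => false := by
  induction r with
  | zero =>
    intro k hk
    apply countCompletions_congr
    intro j _ _
    simp only [strictWord, decide_eq_decide]
    omega
  | succ r ih =>
    intro k hk
    have h1 : strictWord n (k + 1) = false := by simp [strictWord]; omega
    have h2 : strictWord n (k + 1 + 1) = true := by simp [strictWord]; omega
    have h3 : updLink 1 (fun _ => false) 0 = fun _ => false := by
      funext q; simp [updLink]
    rw [show 2 * (r + 1) + 8 = 2 * r + 8 + 1 + 1 by ring, countCompletions, h1,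
      if_neg (by simp), countCompletions, h2, if_pos rfl]
    simp [h3, ih (k + 1 + 1) (by omega)]

theorem countCompletions_strictWord_lt (n : ℕ) :
    countCompletions 0 (strictWord n) (2 * (n + 4)) 0 0 (fun _ => false) <
      countCompletions 1 (strictWord n) (2 * (n + 4)) 0 0 fun _ => false := by
  rw [show 2 * (n + 4) = 2 * n + 8 by ring, countCompletions_strictWord 0 n n 0 (by omega),
    countCompletions_strictWord 1 n n 0 (by omega)]
  decide

theorem card_strictWord (n k : ℕ) : ((Finset.Icc 1 k).filter fun i => strictWord n i = true).card =
    k / 2 - if 2 * n + 2 ≤ k ∧ k < 2 * n + 7 then 1 else 0 := by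
  induction k with
  | zero => simp
  | succ k ih =>
    rw [← Finset.insert_Icc_right_eq_Icc_add_one (by omega), Finset.filter_insert]
    split_ifs with h h' h'
    all_goals
      try rw [Finset.card_insert_of_notMem (by simp)]
      rw [ih]
      simp only [strictWord, decide_eq_true_eq] at h
      split_ifs <;> omega

theorem IsMatchingOn.adj_unique {n : ℕ} {M : SimpleGraph ℕ} (hM : IsMatchingOn n M) {u v v' : ℕ}
    (h : M.Adj u v) (h' : M.Adj u v') : v = v' :=
  have hu := hM.1 u v h
  (hM.2 u hu.1 hu.2.1).unique h h'

theorem exists_strictMono_extension {a b c d e f : ℕ} (ha : 1 ≤ a) (hab : a < b) (hbc : b < c)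
    (hcd : c < d) (hde : d < e) (hef : e < f) :
    ∃ g : ℕ → ℕ, StrictMono g ∧ g 1 = a ∧ g 2 = b ∧ g 3 = c ∧ g 4 = d ∧ g 5 = e ∧ g 6 = f := by
  refine ⟨fun j => match j with
    | 0 => 0 | 1 => a | 2 => b | 3 => c | 4 => d | 5 => e | (j + 6) => f + j,
    strictMono_nat_of_lt_succ fun j => ?_, rfl, rfl, rfl, rfl, rfl, rfl⟩
  match j with
  | 0 | 1 | 2 | 3 | 4 | 5 => simp; omega
  | j + 6 => simp

theorem containsPat_M132 {n : ℕ} {M : SimpleGraph ℕ} (hM : IsMatchingOn n M) {a b c d e f : ℕ}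
    (hab : a < b) (hbc : b < c) (hcd : c < d) (hde : d < e) (hef : e < f)
    (h1 : M.Adj a d) (h2 : M.Adj b f) (h3 : M.Adj c e) : ContainsPat M M132 := by
  obtain ⟨g, hg, g1, g2, g3, g4, g5, g6⟩ :=
    exists_strictMono_extension (hM.1 a d h1).1 hab hbc hcd hde hef
  refine ⟨g, hg, fun u v huv => ?_⟩
  simp only [M132, SimpleGraph.fromRel_adj, List.mem_cons, Prod.mk.injEq, List.not_mem_nil,
    or_false] at huv
  rcases huv.2 with (⟨rfl, rfl⟩ | ⟨rfl, rfl⟩ | ⟨rfl, rfl⟩) |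
    (⟨rfl, rfl⟩ | ⟨rfl, rfl⟩ | ⟨rfl, rfl⟩) <;>
  simp [g1, g2, g3, g4, g5, g6, h1, h2, h3, h1.symm, h2.symm, h3.symm]

theorem ContainsPat.exists_crossing {M : SimpleGraph ℕ} (h : ContainsPat M M123) :
    ∃ a b c d e f : ℕ, a < b ∧ b < c ∧ c < d ∧ d < e ∧ e < f ∧
      M.Adj a d ∧ M.Adj b e ∧ M.Adj c f := by
  obtain ⟨g, hg, h⟩ := h
  refine ⟨g 1, g 2, g 3, g 4, g 5, g 6, hg (by decide), hg (by decide), hg (by decide),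
    hg (by decide), hg (by decide), h _ _ ?_, h _ _ ?_, h _ _ ?_⟩ <;> simp [M123]

theorem finite_setOf_isMatchingOn (n : ℕ) : {M : SimpleGraph ℕ | IsMatchingOn n M}.Finite := by
  classical
  refine Set.Finite.of_finite_image (f := fun M : SimpleGraph ℕ =>
    (Finset.Icc 1 n ×ˢ Finset.Icc 1 n).filter fun e => M.Adj e.1 e.2)
    (((Finset.Icc 1 n ×ˢ Finset.Icc 1 n).powerset.finite_toSet).subset ?_) ?_
  · rintro _ ⟨M, _, rfl⟩
    exact Finset.mem_coe.2 (Finset.mem_powerset.2 (Finset.filter_subset _ _))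
  · intro M hM M' hM' h
    ext u v
    have := congrArg ((u, v) ∈ ·) h
    simp only [Finset.mem_filter, Finset.mem_product, Finset.mem_Icc, eq_iff_iff] at this
    constructor
    · intro huv
      have := hM.1 u v huv
      tauto
    · intro huv
      have := hM'.1 u v huv
      tauto

/-- The matchings on `[n]` with base `w` that avoid `H`. -/
def avoiders (n : ℕ) (w : ℕ → Bool) (H : SimpleGraph ℕ) : Set (SimpleGraph ℕ) :=
  {M | IsMatchingOn n M ∧ HasBase n M w ∧ ¬ ContainsPat M H}

/-- `M` agrees with `G` on the vertex set `{0,…,k}`. -/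
def Extends (k : ℕ) (G M : SimpleGraph ℕ) : Prop :=
  ∀ u v : ℕ, u ≤ k → v ≤ k → (M.Adj u v ↔ G.Adj u v)

theorem finite_avoiders_inter (n : ℕ) (w : ℕ → Bool) (H : SimpleGraph ℕ)
    (P : SimpleGraph ℕ → Prop) : (avoiders n w H ∩ {M | P M}).Finite :=
  (finite_setOf_isMatchingOn n).subset fun _ hM => hM.1.1

/-- `G` is a partial matching on `[k]` with base `w` whose stubs are `t 0 < ⋯ < t (p - 1)`,
and `L q` records whether some edge covers both `t (q - 1)` and `t q`. -/
structure IsPartialMatching (w : ℕ → Bool) (k : ℕ) (G : SimpleGraph ℕ) (p : ℕ) (t : ℕ → ℕ)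
    (L : ℕ → Bool) : Prop where
  pos : ∀ u v, G.Adj u v → 1 ≤ u
  le : ∀ u v, G.Adj u v → u ≤ k
  unique : ∀ u v v', G.Adj u v → G.Adj u v' → v = v'
  base : ∀ v, 1 ≤ v → v ≤ k → (w v = true ↔ ∃ u < v, G.Adj v u)
  lt : ∀ i j, i < j → j < p → t i < t j
  stub : ∀ v, (1 ≤ v ∧ v ≤ k ∧ ∀ u, ¬ G.Adj v u) ↔ ∃ i < p, t i = v
  link : ∀ q, L q = true ↔ 0 < q ∧ q < p ∧ ∃ x y, G.Adj x y ∧ x < t (q - 1) ∧ t q < y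

namespace IsPartialMatching

variable {w : ℕ → Bool} {k p : ℕ} {G : SimpleGraph ℕ} {t : ℕ → ℕ} {L : ℕ → Bool}

theorem zero (w : ℕ → Bool) : IsPartialMatching w 0 ⊥ 0 id fun _ => false where
  pos := by simp
  le := by simp
  unique := by simp
  base := by intro v h h'; omega
  lt := by simp
  stub := by intro v; simp; omega
  link := by simp

theorem stub_mem (h : IsPartialMatching w k G p t L) {i : ℕ} (hi : i < p) :
    1 ≤ t i ∧ t i ≤ k ∧ ∀ u, ¬ G.Adj (t i) u :=
  (h.stub (t i)).2 ⟨i, hi, rfl⟩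

theorem le_of_le (h : IsPartialMatching w k G p t L) {i j : ℕ} (hij : i ≤ j) (hj : j < p) :
    t i ≤ t j := by
  rcases hij.eq_or_lt with rfl | hij
  · exact le_rfl
  · exact (h.lt i j hij hj).le

theorem link_zero (h : IsPartialMatching w k G p t L) : L 0 = false := by
  by_contra h'
  have := (h.link 0).1 (by simpa using h')
  omega

theorem addStub (h : IsPartialMatching w k G p t L) (hw : w (k + 1) = false) :
    IsPartialMatching w (k + 1) G (p + 1) (Function.update t p (k + 1)) L where
  pos := h.pos
  le u v huv := (h.le u v huv).trans (by omega)
  unique := h.unique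
  base v hv hvk := by
    rcases hvk.lt_or_eq with hvk | rfl
    · exact h.base v hv (by omega)
    · simp only [hw, Bool.false_eq_true, false_iff, not_exists, not_and]
      intro u _ hu
      have := h.le _ _ hu
      omega
  lt i j hij hj := by
    rw [Function.update_of_ne (by omega)]
    rcases (Nat.lt_succ_iff.1 hj).lt_or_eq with hj | rfl
    · rw [Function.update_of_ne (by omega)]
      exact h.lt i j hij hj
    · have := (h.stub_mem hij).2.1
      rw [Function.update_self]
      omega
  stub v := by
    constructor
    · rintro ⟨hv, hvk, hu⟩
      rcases hvk.lt_or_eq with hvk | rfl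
      · obtain ⟨i, hi, rfl⟩ := (h.stub v).1 ⟨hv, by omega, hu⟩
        exact ⟨i, by omega, Function.update_of_ne (by omega) _ _⟩
      · exact ⟨p, by omega, Function.update_self ..⟩
    · rintro ⟨i, hi, rfl⟩
      rcases (Nat.lt_succ_iff.1 hi).lt_or_eq with hi | rfl
      · rw [Function.update_of_ne (by omega)]
        have := h.stub_mem hi
        exact ⟨this.1, by omega, this.2.2⟩
      · rw [Function.update_self]
        refine ⟨by omega, le_rfl, fun u hu => ?_⟩
        have := h.le _ _ hu
        omega
  link q := by
    rw [h.link q]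
    constructor
    · rintro ⟨hq, hqp, hxy⟩
      refine ⟨hq, by omega, ?_⟩
      rwa [Function.update_of_ne (by omega), Function.update_of_ne (by omega)]
    · rintro ⟨hq, hqp, x, y, hxy, hx, hy⟩
      rw [Function.update_of_ne (by omega)] at hx
      rcases (Nat.lt_succ_iff.1 hqp).lt_or_eq with hqp | rfl
      · rw [Function.update_of_ne (by omega)] at hy
        exact ⟨hq, hqp, x, y, hxy, hx, hy⟩
      · rw [Function.update_self] at hy
        have := h.le _ _ hxy.symm
        omega

theorem adj_sup_edge {s r : ℕ} (hsr : s ≠ r) (u v : ℕ) :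
    (G ⊔ SimpleGraph.edge s r).Adj u v ↔ G.Adj u v ∨ (u = s ∧ v = r) ∨ (u = r ∧ v = s) := by
  rw [SimpleGraph.sup_adj, SimpleGraph.edge_adj]
  constructor
  · tauto
  · rintro (h | ⟨rfl, rfl⟩ | ⟨rfl, rfl⟩)
    · exact .inl h
    · exact .inr ⟨.inl ⟨rfl, rfl⟩, hsr⟩
    · exact .inr ⟨.inr ⟨rfl, rfl⟩, hsr.symm⟩

theorem addEdge (h : IsPartialMatching w k G p t L) (hw : w (k + 1) = true) {i : ℕ} (hi : i < p)
    (hL : L i = false ∨ L (i + 1) = false) :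
    IsPartialMatching w (k + 1) (G ⊔ SimpleGraph.edge (t i) (k + 1)) (p - 1)
      (fun q => if q < i then t q else t (q + 1)) (updLink p L i) := by
  obtain ⟨hs1, hsk, hs⟩ := h.stub_mem hi
  have hadj := adj_sup_edge (G := G) (s := t i) (r := k + 1) (by omega)
  have hk : ∀ u, ¬ G.Adj (k + 1) u := fun u hu => by have := h.le _ _ hu; omega
  constructor
  · intro u v huv
    rcases (hadj u v).1 huv with huv | ⟨rfl, rfl⟩ | ⟨rfl, rfl⟩
    · exact h.pos u v huv
    · exact hs1
    · omega
  · intro u v huv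
    rcases (hadj u v).1 huv with huv | ⟨rfl, rfl⟩ | ⟨rfl, rfl⟩
    · exact (h.le u v huv).trans (by omega)
    · omega
    · omega
  · intro u v v' huv huv'
    rcases (hadj u v).1 huv with huv | ⟨rfl, rfl⟩ | ⟨rfl, rfl⟩ <;>
    rcases (hadj _ v').1 huv' with huv' | ⟨h1, h2⟩ | ⟨h1, h2⟩
    · exact h.unique u v v' huv huv'
    · exact absurd (h1 ▸ huv) (hs v)
    · exact absurd (h1 ▸ huv) (hk v)
    · exact absurd huv' (hs v')
    · exact h2.symm
    · omega
    · exact absurd huv' (hk v')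
    · omega
    · exact h2.symm
  · intro v hv hvk
    rcases hvk.lt_or_eq with hvk | rfl
    · rw [h.base v hv (by omega)]
      constructor
      · rintro ⟨u, hu, hvu⟩
        exact ⟨u, hu, (hadj v u).2 (.inl hvu)⟩
      · rintro ⟨u, hu, hvu⟩
        rcases (hadj v u).1 hvu with hvu | ⟨rfl, rfl⟩ | ⟨rfl, rfl⟩
        · exact ⟨u, hu, hvu⟩
        · omega
        · omega
    · simp only [hw, true_iff]
      exact ⟨t i, by omega, (hadj _ _).2 (.inr (.inr ⟨rfl, rfl⟩))⟩
  · intro a b hab hb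
    split_ifs <;> exact h.lt _ _ (by omega) (by omega)
  · intro v
    constructor
    · rintro ⟨hv, hvk, hu⟩
      have hvk' : v ≠ k + 1 := by
        rintro rfl
        exact hu (t i) ((hadj _ _).2 (.inr (.inr ⟨rfl, rfl⟩)))
      obtain ⟨j, hj, rfl⟩ := (h.stub v).1
        ⟨hv, by omega, fun u hvu => hu u ((hadj _ _).2 (.inl hvu))⟩
      rcases lt_trichotomy j i with hji | rfl | hji
      · exact ⟨j, by omega, by simp [hji]⟩
      · exact absurd ((hadj _ _).2 (.inr (.inl ⟨rfl, rfl⟩))) (hu (k + 1))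
      · refine ⟨j - 1, by omega, ?_⟩
        rw [if_neg (by omega), show j - 1 + 1 = j by omega]
    · rintro ⟨j, hj, rfl⟩
      obtain ⟨j', hj', hji, hjt⟩ :
          ∃ j' < p, t j' ≠ t i ∧ (if j < i then t j else t (j + 1)) = t j' := by
        split_ifs with hji
        · exact ⟨j, by omega, (h.lt j i hji hi).ne, rfl⟩
        · exact ⟨j + 1, by omega, (h.lt i (j + 1) (by omega) (by omega)).ne', rfl⟩
      rw [hjt]
      have hst := h.stub_mem hj'
      refine ⟨hst.1, by omega, fun u hu => ?_⟩
      rcases (hadj _ _).1 hu with hu | ⟨hu, _⟩ | ⟨hu, _⟩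
      · exact hst.2.2 u hu
      · exact hji hu
      · omega
  · intro q
    simp only [updLink]
    rcases lt_trichotomy q i with hqi | rfl | hqi
    · rw [if_pos hqi, if_pos hqi, h.link]
      constructor
      · rintro ⟨hq, hqp, x, y, hxy, hx, hy⟩
        refine ⟨hq, by omega, x, y, (hadj x y).2 (.inl hxy), ?_, hy⟩
        rwa [if_pos (by omega)]
      · rintro ⟨hq, hqp, x, y, hxy, hx, hy⟩
        rw [if_pos (by omega)] at hx
        refine ⟨hq, by omega, x, y, ?_, hx, hy⟩
        have hst := h.stub_mem (show q < p by omega)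
        have := h.le_of_le (show q - 1 ≤ i by omega) hi
        rcases (hadj x y).1 hxy with hxy | ⟨rfl, rfl⟩ | ⟨rfl, rfl⟩
        · exact hxy
        · omega
        · omega
    · simp only [lt_irrefl, if_false, false_and, decide_false, Bool.false_eq_true, false_iff]
      rintro ⟨hq, hqp, x, y, hxy, hx, hy⟩
      rw [if_pos (by omega)] at hx
      have h1 := h.lt (q - 1) q (by omega) hi
      have h2 := h.lt q (q + 1) (by omega) (by omega)
      rcases (hadj x y).1 hxy with hxy | ⟨rfl, rfl⟩ | ⟨rfl, rfl⟩
      · rcases hL with hL | hL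
        · rw [(h.link q).2 ⟨hq, hi, x, y, hxy, hx, by omega⟩] at hL
          simp at hL
        · rw [(h.link (q + 1)).2 ⟨by omega, by omega, x, y, hxy, by simp; omega, hy⟩] at hL
          simp at hL
      · omega
      · omega
    · rw [if_neg (by omega), if_neg (by omega), if_neg (by omega), decide_eq_true_eq]
      constructor
      · rintro ⟨_, hqp⟩
        have := (h.stub_mem hqp).2.1
        refine ⟨by omega, by omega, t i, k + 1, (hadj _ _).2 (.inr (.inl ⟨rfl, rfl⟩)), ?_, ?_⟩
        · exact h.lt _ _ (by omega) (by omega)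
        · omega
      · omega

end IsPartialMatching

theorem Extends.sup_edge {w : ℕ → Bool} {n k p i : ℕ} {G M : SimpleGraph ℕ} {t : ℕ → ℕ}
    {L : ℕ → Bool} (hG : IsPartialMatching w k G p t L) (hi : i < p) (hM : IsMatchingOn n M) :
    Extends (k + 1) (G ⊔ SimpleGraph.edge (t i) (k + 1)) M ↔
      Extends k G M ∧ M.Adj (t i) (k + 1) := by
  obtain ⟨hs1, hsk, hs⟩ := hG.stub_mem hi
  have hadj := IsPartialMatching.adj_sup_edge (G := G) (s := t i) (r := k + 1) (by omega)
  have hk : ∀ u, ¬ G.Adj (k + 1) u := fun u hu => by have := hG.le _ _ hu; omega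
  constructor
  · intro h
    refine ⟨fun u v hu hv => ?_, ?_⟩
    · rw [h u v (by omega) (by omega), hadj]
      constructor
      · rintro (h | h | h)
        · exact h
        · omega
        · omega
      · exact .inl
    · exact (h _ _ (by omega) le_rfl).2 ((hadj _ _).2 (.inr (.inl ⟨rfl, rfl⟩)))
  · rintro ⟨h, hMt⟩ u v hu hv
    rw [hadj]
    rcases hu.lt_or_eq with hu | rfl <;> rcases hv.lt_or_eq with hv | rfl
    · rw [h u v (by omega) (by omega)]
      constructor
      · exact .inl
      · rintro (h | h | h)
        · exact h
        · omega
        · omega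
    · constructor
      · intro huv
        exact .inr (.inl ⟨hM.adj_unique huv.symm hMt.symm, rfl⟩)
      · rintro (h | ⟨rfl, _⟩ | ⟨h, _⟩)
        · exact absurd h.symm (hk u)
        · exact hMt
        · omega
    · constructor
      · intro huv
        exact .inr (.inr ⟨rfl, hM.adj_unique huv hMt.symm⟩)
      · rintro (h | ⟨_, h⟩ | ⟨_, rfl⟩)
        · exact absurd h (hk v)
        · omega
        · exact hMt.symm
    · simp only [SimpleGraph.irrefl, false_or, false_iff]
      omega

theorem Extends.succ {w : ℕ → Bool} {n k : ℕ} {G M : SimpleGraph ℕ} (hGk : ∀ u v, G.Adj u v → u ≤ k)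
    (hkn : k + 1 ≤ n) (hw : w (k + 1) = false) (hM : HasBase n M w) :
    Extends (k + 1) G M ↔ Extends k G M := by
  refine ⟨fun h u v hu hv => h u v (by omega) (by omega), fun h u v hu hv => ?_⟩
  have hno : ∀ v, v ≤ k + 1 → (M.Adj (k + 1) v ↔ G.Adj (k + 1) v) := fun v hv => by
    constructor
    · intro huv
      rcases hv.lt_or_eq with hv | rfl
      · have := (hM (k + 1) (by omega) hkn).2 ⟨v, hv, huv⟩
        simp [hw] at this
      · exact absurd huv (M.irrefl)
    · intro huv
      have := hGk _ _ huv
      omega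
  rcases hu.lt_or_eq with hu | rfl
  · rcases hv.lt_or_eq with hv | rfl
    · exact h u v (by omega) (by omega)
    · rw [M.adj_comm, G.adj_comm, hno u (by omega)]
  · exact hno v hv

theorem ncard_avoiders_M132_le (w : ℕ → Bool) (n d : ℕ) :
    ∀ (k : ℕ) (G : SimpleGraph ℕ) (p : ℕ) (t : ℕ → ℕ) (L : ℕ → Bool), k + d = n →
      IsPartialMatching w k G p t L →
      (avoiders n w M132 ∩ {M | Extends k G M}).ncard ≤ countCompletions 0 w d k p L := by
  induction d with
  | zero =>
    rintro k G p t L rfl hG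
    have hsub : avoiders k w M132 ∩ {M | Extends k G M} ⊆ {G} := by
      rintro M ⟨⟨hM, -, -⟩, hMG⟩
      ext u v
      constructor
      · intro huv
        have := hM.1 u v huv
        exact (hMG u v this.2.1 this.2.2.2).1 huv
      · intro huv
        exact (hMG u v (hG.le _ _ huv) (hG.le _ _ huv.symm)).2 huv
    rw [countCompletions]
    split_ifs with hp
    · exact (Set.ncard_le_ncard hsub).trans (Set.ncard_singleton G).le
    · rw [Nat.le_zero, Set.ncard_eq_zero (finite_avoiders_inter ..), Set.eq_empty_iff_forall_notMem]
      intro M hM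
      obtain rfl := hsub hM
      obtain ⟨h1, hk, hst⟩ := hG.stub_mem (Nat.pos_of_ne_zero hp)
      obtain ⟨u, hu, -⟩ := hM.1.1.2 _ h1 hk
      exact hst u hu
  | succ d ih =>
    intro k G p t L hk hG
    rw [countCompletions]
    split_ifs with hw
    · have hsub : avoiders n w M132 ∩ {M | Extends k G M} ⊆
          ⋃ i ∈ (Finset.range p).filter fun i => L i = false,
            avoiders n w M132 ∩ {M | Extends (k + 1) (G ⊔ SimpleGraph.edge (t i) (k + 1)) M} := by
        rintro M ⟨⟨hM, hMw, hav⟩, hMG⟩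
        obtain ⟨s, hsk, hs⟩ := (hMw (k + 1) (by omega) (by omega)).1 hw
        have hMG' : ∀ u v, G.Adj u v → M.Adj u v := fun u v huv =>
          (hMG u v (hG.le _ _ huv) (hG.le _ _ huv.symm)).2 huv
        obtain ⟨i, hi, rfl⟩ := (hG.stub s).1 ⟨(hM.1 _ _ hs.symm).1, by omega, fun u hu => by
          have := hM.adj_unique (hMG' _ _ hu) hs.symm
          have := hG.le _ _ hu.symm
          omega⟩
        simp only [Set.mem_iUnion, Finset.mem_filter, Finset.mem_range]
        refine ⟨i, ⟨hi, ?_⟩, ⟨hM, hMw, hav⟩, (Extends.sup_edge hG hi hM).2 ⟨hMG, hs.symm⟩⟩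
        by_contra hL
        obtain ⟨hi0, -, x, y, hxy, hx, hy⟩ := (hG.link i).1 (by simpa using hL)
        have hst := hG.stub_mem (show i - 1 < p by omega)
        have hlt := hG.lt (i - 1) i (by omega) hi
        have hyk := hG.le _ _ hxy.symm
        obtain ⟨z, hz, -⟩ := hM.2 (t (i - 1)) hst.1 (by omega)
        refine hav (containsPat_M132 hM hx hlt hy (by omega) ?_ (hMG' _ _ hxy) hz hs.symm)
        by_contra hzk
        rcases (not_lt.1 hzk).lt_or_eq with hzk | rfl
        · exact hst.2.2 z ((hMG _ _ hst.2.1 (by omega)).1 hz)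
        · have := hM.adj_unique hz.symm hs
          omega
      refine (Set.ncard_le_ncard hsub ?_).trans ((Finset.set_ncard_biUnion_le _ _).trans ?_)
      · exact Set.Finite.biUnion (Finset.finite_toSet _) fun i _ => finite_avoiders_inter ..
      rw [Finset.sum_filter]
      refine Finset.sum_le_sum fun i hi => ?_
      rw [Finset.mem_range] at hi
      by_cases hL : L i = false
      · simpa [hL] using ih (k + 1) _ _ _ _ (by omega) (hG.addEdge hw hi (.inl hL))
      · simp [hL]
    · have hw' : w (k + 1) = false := by simpa using hw
      refine (Set.ncard_le_ncard ?_ (finite_avoiders_inter ..)).trans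
        (ih (k + 1) G _ _ _ (by omega) (hG.addStub hw'))
      rintro M ⟨hM, hMG⟩
      exact ⟨hM, (Extends.succ hG.le (by omega) hw' hM.2.1).2 hMG⟩

/-- Whenever two crossing edges of `G` cover a common vertex, that vertex is matched
to the left of the right end of the crossing. -/
def CrossingsClosed (G : SimpleGraph ℕ) : Prop :=
  ∀ x y x' y' v : ℕ, G.Adj x y → G.Adj x' y' → x < x' → x' < v → v < y → y < y' →
    ∃ z < y', G.Adj v z

theorem CrossingsClosed.sup_edge {w : ℕ → Bool} {k p i : ℕ} {G : SimpleGraph ℕ} {t : ℕ → ℕ}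
    {L : ℕ → Bool} (hc : CrossingsClosed G) (hG : IsPartialMatching w k G p t L) (hi : i < p)
    (hL : L (i + 1) = false) : CrossingsClosed (G ⊔ SimpleGraph.edge (t i) (k + 1)) := by
  have hst := hG.stub_mem hi
  have hadj := IsPartialMatching.adj_sup_edge (G := G) (s := t i) (r := k + 1) (by omega)
  intro x y x' y' v hxy hxy' h1 h2 h3 h4
  rw [hadj] at hxy hxy'
  have hy' : y' ≤ k + 1 := by
    rcases hxy' with h | h | h
    · have := hG.le _ _ h.symm
      omega
    · omega
    · omega
  replace hxy : G.Adj x y := by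
    rcases hxy with h | h | h
    · exact h
    · omega
    · omega
  rcases hxy' with hxy' | ⟨rfl, rfl⟩ | h
  · obtain ⟨z, hz, hvz⟩ := hc x y x' y' v hxy hxy' h1 h2 h3 h4
    exact ⟨z, hz, (hadj _ _).2 (.inl hvz)⟩
  · by_cases hv : ∃ z, G.Adj v z
    · obtain ⟨z, hz⟩ := hv
      exact ⟨z, Nat.lt_succ_of_le (hG.le _ _ hz.symm), (hadj _ _).2 (.inl hz)⟩
    · obtain ⟨j, hj, rfl⟩ := (hG.stub v).1 ⟨by omega, by omega, not_exists.1 hv⟩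
      have hij : i < j := by
        by_contra hji
        have := hG.le_of_le (not_lt.1 hji) hi
        omega
      have := hG.le_of_le (show i + 1 ≤ j by omega) hj
      rw [(hG.link (i + 1)).2 ⟨by omega, by omega, x, y, hxy, h1, by omega⟩] at hL
      simp at hL
  · omega

theorem CrossingsClosed.not_containsPat {G : SimpleGraph ℕ} (hc : CrossingsClosed G)
    (hu : ∀ u v v', G.Adj u v → G.Adj u v' → v = v') : ¬ ContainsPat G M123 := by
  intro h
  obtain ⟨a, b, c, d, e, f, hab, hbc, hcd, hde, hef, h1, h2, h3⟩ := h.exists_crossing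
  obtain ⟨z, hz, hcz⟩ := hc a d b e c h1 h2 hab hbc hcd hde
  have := hu _ _ _ h3 hcz
  omega

theorem le_ncard_avoiders_M123 (w : ℕ → Bool) (n d : ℕ) :
    ∀ (k : ℕ) (G : SimpleGraph ℕ) (p : ℕ) (t : ℕ → ℕ) (L : ℕ → Bool), k + d = n →
      IsPartialMatching w k G p t L → CrossingsClosed G →
      countCompletions 1 w d k p L ≤ (avoiders n w M123 ∩ {M | Extends k G M}).ncard := by
  induction d with
  | zero =>
    rintro k G p t L rfl hG hc
    rw [countCompletions]
    split_ifs with hp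
    · subst hp
      refine (Set.ncard_pos (finite_avoiders_inter ..)).2
        ⟨G, ⟨⟨fun u v huv => ⟨hG.pos _ _ huv, hG.le _ _ huv, hG.pos _ _ huv.symm,
          hG.le _ _ huv.symm⟩, fun v hv hvk => ?_⟩, hG.base, hc.not_containsPat hG.unique⟩,
          fun _ _ _ _ => Iff.rfl⟩
      have hu : ∃ u, G.Adj v u := by
        by_contra hu
        obtain ⟨i, hi, -⟩ := (hG.stub v).1 ⟨hv, hvk, not_exists.1 hu⟩
        omega
      obtain ⟨u, hu⟩ := hu
      exact ⟨u, hu, fun u' hu' => hG.unique _ _ _ hu' hu⟩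
    · exact Nat.zero_le _
  | succ d ih =>
    intro k G p t L hk hG hc
    rw [countCompletions]
    split_ifs with hw
    · set S := fun i => avoiders n w M123 ∩
        {M | Extends (k + 1) (G ⊔ SimpleGraph.edge (t i) (k + 1)) M}
      set I := (Finset.range p).filter fun i => L (i + 1) = false
      have hI : ∀ i ∈ I, i < p ∧ L (i + 1) = false := fun i hi => by simpa [I] using hi
      have hfin : ∀ i, (S i).Finite := fun i => finite_avoiders_inter ..
      have hsum : ∑ i ∈ I, (S i).ncard = (⋃ i ∈ (I : Set ℕ), S i).ncard := by
        rw [Set.Finite.ncard_biUnion I.finite_toSet fun i _ => hfin i,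
          finsum_mem_coe_finset]
        intro i hi j hj hij
        rw [Function.onFun, Set.disjoint_left]
        rintro M ⟨hM, hMi⟩ ⟨-, hMj⟩
        have h1 := ((Extends.sup_edge hG (hI i hi).1 hM.1).1 hMi).2
        have h2 := ((Extends.sup_edge hG (hI j hj).1 hM.1).1 hMj).2
        have h3 := hM.1.adj_unique h1.symm h2.symm
        rcases lt_or_gt_of_ne hij with hij | hij
        · have := hG.lt i j hij (hI j hj).1
          omega
        · have := hG.lt j i hij (hI i hi).1
          omega
      calc _ ≤ ∑ i ∈ I, (S i).ncard := by
            rw [Finset.sum_filter]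
            refine Finset.sum_le_sum fun i hi => ?_
            rw [Finset.mem_range] at hi
            by_cases hL : L (i + 1) = false
            · simpa [hL] using ih (k + 1) _ _ _ _ (by omega) (hG.addEdge hw hi (.inr hL))
                (hc.sup_edge hG hi hL)
            · simp [hL]
        _ ≤ _ := by
            rw [hsum]
            refine Set.ncard_le_ncard ?_ (finite_avoiders_inter ..)
            simp only [Set.iUnion_subset_iff]
            rintro i hi M ⟨hM, hMi⟩
            exact ⟨hM, ((Extends.sup_edge hG (hI i hi).1 hM.1).1 hMi).1⟩
    · have hw' : w (k + 1) = false := by simpa using hw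
      refine (ih (k + 1) G _ _ _ (by omega) (hG.addStub hw') hc).trans
        (Set.ncard_le_ncard ?_ (finite_avoiders_inter ..))
      rintro M ⟨hM, hMG⟩
      exact ⟨hM, (Extends.succ hG.le (by omega) hw' hM.2.1).1 hMG⟩

theorem avoiders_inter_extends_zero (n : ℕ) (w : ℕ → Bool) (H : SimpleGraph ℕ) :
    avoiders n w H ∩ {M | Extends 0 ⊥ M} = avoiders n w H := by
  refine Set.inter_eq_left.2 fun M hM u v hu _ => ?_
  simp only [SimpleGraph.bot_adj, iff_false]
  intro huv
  have := hM.1.1 u v huv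
  omega

theorem ncard_avoiders_M132_le_countCompletions (n : ℕ) (w : ℕ → Bool) :
    (avoiders n w M132).ncard ≤ countCompletions 0 w n 0 0 fun _ => false := by
  rw [← avoiders_inter_extends_zero]
  exact ncard_avoiders_M132_le w n n 0 ⊥ 0 id _ (zero_add n) (.zero w)

theorem countCompletions_le_ncard_avoiders_M123 (n : ℕ) (w : ℕ → Bool) :
    (countCompletions 1 w n 0 0 fun _ => false) ≤ (avoiders n w M123).ncard := by
  rw [← avoiders_inter_extends_zero]
  exact le_ncard_avoiders_M123 w n n 0 ⊥ 0 id _ (zero_add n) (.zero w) (by simp [CrossingsClosed])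

theorem ncard_avoiders_M132_le_M123 (n : ℕ) (w : ℕ → Bool) :
    (avoiders n w M132).ncard ≤ (avoiders n w M123).ncard :=
  (ncard_avoiders_M132_le_countCompletions n w).trans <|
    (countCompletions_zero_le_one w n 0 0 _ _ rfl (fun _ _ => rfl) fun _ => id).trans
      (countCompletions_le_ncard_avoiders_M123 n w)

theorem ncard_avoiders_strictWord_lt (n : ℕ) :
    (avoiders (2 * (n + 4)) (strictWord n) M132).ncard <
      (avoiders (2 * (n + 4)) (strictWord n) M123).ncard :=
  (ncard_avoiders_M132_le_countCompletions _ _).trans_lt <|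
    (countCompletions_strictWord_lt n).trans_le (countCompletions_le_ncard_avoiders_M123 _ _)

theorem isDyckWord_strictWord (n : ℕ) : IsDyckWord (2 * (n + 4)) (strictWord n) := by
  refine ⟨?_, fun k _ => ?_⟩ <;> rw [card_strictWord] <;> split_ifs <;> omega

theorem avoiders_congr (n : ℕ) {w w' : ℕ → Bool} (H : SimpleGraph ℕ)
    (h : ∀ i, 1 ≤ i → i ≤ n → w i = w' i) : avoiders n w H = avoiders n w' H := by
  have : ∀ M, HasBase n M w ↔ HasBase n M w' := fun M =>
    forall_congr' fun i => forall_congr' fun h1 => forall_congr' fun h2 => by rw [h i h1 h2]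
  ext M
  simp only [avoiders, this]

theorem ncard_avoiding_eq_sum (n : ℕ) (H : SimpleGraph ℕ) :
    {M : SimpleGraph ℕ | IsMatchingOn n M ∧ ¬ ContainsPat M H}.ncard =
      ∑ W ∈ (Finset.Icc 1 n).powerset, (avoiders n (fun i => decide (i ∈ W)) H).ncard := by
  classical
  have hunion : {M : SimpleGraph ℕ | IsMatchingOn n M ∧ ¬ ContainsPat M H} =
      ⋃ W ∈ ((Finset.Icc 1 n).powerset : Set (Finset ℕ)),
        avoiders n (fun i => decide (i ∈ W)) H := by
    ext M
    simp only [Set.mem_iUnion]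
    constructor
    · rintro ⟨hM, hH⟩
      refine ⟨(Finset.Icc 1 n).filter fun i => ∃ j < i, M.Adj i j,
        Finset.mem_coe.2 (Finset.mem_powerset.2 (Finset.filter_subset _ _)), hM, ?_, hH⟩
      intro i h1 hn
      simp [h1, hn]
    · rintro ⟨W, -, hM, -, hH⟩
      exact ⟨hM, hH⟩
  rw [hunion, Set.Finite.ncard_biUnion (Finset.finite_toSet _), finsum_mem_coe_finset]
  · exact fun W _ => (finite_setOf_isMatchingOn n).subset fun _ hM => hM.1
  · intro W hW W' hW' hne
    rw [Function.onFun, Set.disjoint_left]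
    rintro M ⟨-, hM, -⟩ ⟨-, hM', -⟩
    refine hne (Finset.ext fun i => ?_)
    simp only [Finset.coe_powerset, Set.mem_preimage, Set.mem_powerset_iff, Finset.coe_subset]
      at hW hW'
    constructor
    · intro hi
      have := Finset.mem_Icc.1 (hW hi)
      simpa using (hM' i this.1 this.2).2 ((hM i this.1 this.2).1 (by simpa using hi))
    · intro hi
      have := Finset.mem_Icc.1 (hW' hi)
      simpa using (hM i this.1 this.2).2 ((hM' i this.1 this.2).1 (by simpa using hi))

/-- for every `m ≥ 4` there is a Dyck word `w` of length `2m` with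
`g(m,w,M_132) < g(m,w,M_123)`; consequently `g(m,M_132) < g(m,M_123)` for every `m ≥ 4`. -/
theorem stmt4 (m : ℕ) (hm : 4 ≤ m) :
    (∃ w : ℕ → Bool, IsDyckWord (2*m) w ∧
      Nat.card {G : SimpleGraph ℕ // IsMatchingOn (2*m) G ∧ HasBase (2*m) G w ∧
        ¬ ContainsPat G M132} <
      Nat.card {G : SimpleGraph ℕ // IsMatchingOn (2*m) G ∧ HasBase (2*m) G w ∧
        ¬ ContainsPat G M123}) ∧
    Nat.card {G : SimpleGraph ℕ // IsMatchingOn (2*m) G ∧ ¬ ContainsPat G M132} <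
    Nat.card {G : SimpleGraph ℕ // IsMatchingOn (2*m) G ∧ ¬ ContainsPat G M123} := by
  obtain ⟨n, rfl⟩ : ∃ n, m = n + 4 := ⟨m - 4, by omega⟩
  refine ⟨⟨strictWord n, isDyckWord_strictWord n, ncard_avoiders_strictWord_lt n⟩, ?_⟩
  change Set.ncard {M : SimpleGraph ℕ | IsMatchingOn (2 * (n + 4)) M ∧ ¬ ContainsPat M M132} <
    Set.ncard {M : SimpleGraph ℕ | IsMatchingOn (2 * (n + 4)) M ∧ ¬ ContainsPat M M123}
  rw [ncard_avoiding_eq_sum, ncard_avoiding_eq_sum]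
  refine Finset.sum_lt_sum (fun W _ => ncard_avoiders_M132_le_M123 _ _)
    ⟨(Finset.Icc 1 (2 * (n + 4))).filter fun i => strictWord n i = true,
      Finset.mem_powerset.2 (Finset.filter_subset _ _), ?_⟩
  have hcongr := fun H => avoiders_congr (2 * (n + 4)) (w := strictWord n)
    (w' := fun i => decide (i ∈ (Finset.Icc 1 (2 * (n + 4))).filter fun i => strictWord n i = true))
    H fun i h1 h2 => by simp [h1, h2]
  rw [← hcongr, ← hcongr]
  exact ncard_avoiders_strictWord_lt n
end
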